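/- arXiv:2510.23102 — 3 statements merged into one kernel-verified Lean document; each statement's English description precedes it below -/
import Mathlib

section
/- Let τ be a finite non-planar rooted tree with at least two vertices. Let CM(τ) be the number of natural-growth sequences producing τ (sequences of graftings of single new leaves, starting from the single-vertex tree), let σ(τ) be the order of the automorphism group of τ, and let T⁻(τ) be the set of rooted trees obtained from τ by removing one leaf together with its edge. Then σ(τ)·CM(τ) = Σ_{τ' ∈ T⁻(τ)} σ(τ')·CM(τ'). -/
/-- A finite non-planar rooted tree: vertex set `Fin (n+1)`, distinguished root `0`,
and edges oriented towards the root, encoded by the parent map (the root is a fixed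
point of the parent map, and every vertex reaches the root by iterating it). -/
structure RTree : Type where
  n : ℕ
  parent : Fin (n + 1) → Fin (n + 1)
  parent_root : parent 0 = 0
  reaches_root : ∀ v, parent^[n] v = 0

namespace RTree

/-- Isomorphism of rooted trees: a root-preserving bijection of vertices commuting
with the parent maps. -/
def Iso (t₁ t₂ : RTree) : Prop :=
  ∃ e : Fin (t₁.n + 1) ≃ Fin (t₂.n + 1), e 0 = 0 ∧ ∀ v, t₂.parent (e v) = e (t₁.parent v)

/-- `σ(τ)`: the order of the automorphism group of `τ` (root-preserving graph
automorphisms). -/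
noncomputable def sigma (t : RTree) : ℕ :=
  Nat.card {g : Equiv.Perm (Fin (t.n + 1)) //
    g 0 = 0 ∧ ∀ v, t.parent (g v) = g (t.parent v)}

/-- A rooted tree is monotonically labelled if every non-root vertex is larger than
its parent; such a tree records a natural-growth sequence (the label of a vertex
being the step at which the corresponding new leaf was grafted). -/
def IsMonotoneLabelled (t : RTree) : Prop :=
  ∀ v : Fin (t.n + 1), v ≠ 0 → t.parent v < v

/-- `CM(τ)`: the number of natural-growth sequences producing `τ`, i.e. the number of
monotonically labelled rooted trees isomorphic to `τ` (a natural-growth sequence,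
starting from the single-vertex tree and grafting one new leaf at each step, is
faithfully recorded by labelling each vertex with its creation step). -/
noncomputable def CM (t : RTree) : ℕ :=
  Nat.card {s : RTree // s.IsMonotoneLabelled ∧ Iso s t}

/-- The leaves of `t`: non-root vertices with no incoming edge. -/
def leaves (t : RTree) : Finset (Fin (t.n + 1)) :=
  Finset.univ.filter fun v => v ≠ 0 ∧ ∀ w, t.parent w = v → w = v

/-- `t'` is (a copy of) the rooted tree obtained from `t` by removing the leaf `ℓ`
together with its edge. -/
def IsLeafRemoval (t : RTree) (ℓ : Fin (t.n + 1)) (t' : RTree) : Prop :=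
  ℓ ∈ t.leaves ∧
  ∃ e : Fin (t'.n + 1) ↪ Fin (t.n + 1), e 0 = 0 ∧ Set.range e = {u | u ≠ ℓ} ∧
    ∀ w, t.parent (e w) = e (t'.parent w)

end RTree

open RTree

namespace RTree

/-- Increasing labellings of the vertices of `t` by `0, …, t.n`. -/
def IncLabelling (t : RTree) : Type :=
  {f : Fin (t.n + 1) → ℕ // Function.Injective f ∧ (∀ v, f v ≤ t.n) ∧ f 0 = 0 ∧
    ∀ v, v ≠ 0 → f (t.parent v) < f v}

/-- Increasing labellings, seen as bijections from labels to vertices. -/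
def IncEnum (t : RTree) : Type :=
  {e : Equiv.Perm (Fin (t.n + 1)) // e 0 = 0 ∧ ∀ v, v ≠ 0 → e⁻¹ (t.parent (e v)) < v}

/-- Parent maps of the monotonically labelled trees isomorphic to `t`. -/
def MonoParent (t : RTree) : Type :=
  {p : Fin (t.n + 1) → Fin (t.n + 1) // (∀ v, v ≠ 0 → p v < v) ∧
    ∃ e : Equiv.Perm (Fin (t.n + 1)), e 0 = 0 ∧ ∀ v, t.parent (e v) = e (p v)}

theorem card_monoParent (t : RTree) : Nat.card t.MonoParent = t.CM := by
  have root (p : t.MonoParent) : p.1 0 = 0 := by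
    obtain ⟨p, -, e, h0, he⟩ := p
    apply e.injective
    rw [← he, h0, t.parent_root]
  have reach (p : t.MonoParent) (v) : p.1^[t.n] v = 0 := by
    obtain ⟨p, -, e, h0, he⟩ := p
    apply e.injective
    have hs : Function.Semiconj e p t.parent := fun v => (he v).symm
    rw [(hs.iterate_right t.n).eq, t.reaches_root, h0]
  refine Nat.card_eq_of_bijective
    (fun p : t.MonoParent => (⟨⟨t.n, p.1, root p, reach p⟩, p.2⟩ :
      {s : RTree // s.IsMonotoneLabelled ∧ Iso s t})) ⟨?_, ?_⟩
  · intro p q h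
    have h' := congrArg Subtype.val h
    simp only [RTree.mk.injEq, heq_eq_eq, true_and] at h'
    exact Subtype.ext h'
  · rintro ⟨⟨n, p, h0, hreach⟩, hm, e, he0, he⟩
    have hn : n = t.n := by
      have := Fintype.card_congr e
      simpa using this
    subst hn
    exact ⟨⟨p, hm, e, he0, he⟩, rfl⟩

theorem card_incEnum (t : RTree) : Nat.card t.IncEnum = t.sigma * t.CM := by
  rw [← card_monoParent, sigma, ← Nat.card_prod]
  symm
  choose c hc0 hc using fun p : t.MonoParent => p.2.2
  have hp (p : t.MonoParent) (g : Equiv.Perm (Fin (t.n + 1)))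
      (hg : ∀ v, t.parent (g v) = g (t.parent v)) (v) :
      (g * c p)⁻¹ (t.parent ((g * c p) v)) = p.1 v := by
    rw [Equiv.Perm.inv_eq_iff_eq, Equiv.Perm.mul_apply, Equiv.Perm.mul_apply, hg, hc]
  refine Nat.card_eq_of_bijective
    (fun x => (⟨x.1.1 * c x.2, by simp [hc0, x.1.2.1], fun v hv => by
      rw [hp _ _ x.1.2.2]; exact x.2.2.1 v hv⟩ : t.IncEnum)) ⟨?_, ?_⟩
  · rintro ⟨⟨g, hg0, hg⟩, p⟩ ⟨⟨g', hg0', hg'⟩, p'⟩ h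
    have h' : g * c p = g' * c p' := congrArg Subtype.val h
    have hpp : p = p' := by
      apply Subtype.ext
      funext v
      rw [← hp p g hg, ← hp p' g' hg', h']
    subst hpp
    have hgg : g = g' := mul_right_cancel h'
    subst hgg
    rfl
  · rintro ⟨e, he0, he⟩
    let p : t.MonoParent := ⟨fun v => e⁻¹ (t.parent (e v)), he, e, he0, fun v => by simp⟩
    have hcp : ∀ v, t.parent (c p v) = c p (e⁻¹ (t.parent (e v))) := hc p
    refine ⟨⟨⟨e * (c p)⁻¹, ?_, fun v => ?_⟩, p⟩, ?_⟩
    · have : (c p)⁻¹ 0 = 0 := by rw [Equiv.Perm.inv_eq_iff_eq, hc0]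
      rw [Equiv.Perm.mul_apply, this, he0]
    · have h := hcp ((c p)⁻¹ v)
      have hcv : c p ((c p)⁻¹ v) = v := Equiv.apply_symm_apply _ _
      have hinv : (c p)⁻¹ (t.parent v) = e⁻¹ (t.parent (e ((c p)⁻¹ v))) := by
        rw [Equiv.Perm.inv_eq_iff_eq, ← h, hcv]
      rw [Equiv.Perm.mul_apply, Equiv.Perm.mul_apply, hinv]
      exact (Equiv.apply_symm_apply e _).symm
    · exact Subtype.ext (by simp)

theorem exists_enum_of_incLabelling {t : RTree} (f : t.IncLabelling) :
    ∃ e : Equiv.Perm (Fin (t.n + 1)), ∀ v, (e v : ℕ) = f.1 v := by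
  let g : Fin (t.n + 1) → Fin (t.n + 1) := fun v => ⟨f.1 v, Nat.lt_succ_of_le (f.2.2.1 v)⟩
  have hg : Function.Injective g := fun v w h => f.2.1 (by simpa [g] using h)
  exact ⟨Equiv.ofBijective g (Finite.injective_iff_bijective.mp hg), fun v => rfl⟩

theorem card_incLabelling (t : RTree) : Nat.card t.IncLabelling = t.sigma * t.CM := by
  rw [← card_incEnum]
  symm
  refine Nat.card_eq_of_bijective
    (fun e : t.IncEnum => (⟨fun v => (e.1⁻¹ v : Fin (t.n + 1)), ?_, ?_, ?_, ?_⟩ :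
      t.IncLabelling)) ⟨?_, ?_⟩
  · exact fun v w h => e.1⁻¹.injective (Fin.ext h)
  · exact fun v => Nat.le_of_lt_succ (Fin.is_lt _)
  · have : e.1⁻¹ 0 = 0 := by rw [Equiv.Perm.inv_eq_iff_eq, e.2.1]
    simp [this]
  · intro v hv
    have h := e.2.2 (e.1⁻¹ v) (by rw [Ne, Equiv.Perm.inv_eq_iff_eq, e.2.1]; exact hv)
    simpa using h
  · intro e e' h
    have h' := congrArg Subtype.val h
    apply Subtype.ext
    apply inv_injective
    ext v
    exact congrFun h' v
  · intro f
    obtain ⟨e, he⟩ := exists_enum_of_incLabelling f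
    refine ⟨⟨e⁻¹, ?_, fun v hv => ?_⟩, ?_⟩
    · rw [Equiv.Perm.inv_eq_iff_eq]
      apply Fin.ext
      rw [he, f.2.2.2.1]
      rfl
    · have hv' : e⁻¹ v ≠ 0 := by
        intro h
        rw [Equiv.Perm.inv_eq_iff_eq] at h
        apply hv
        rw [h]
        apply Fin.ext
        rw [he, f.2.2.2.1]
        rfl
      have h := f.2.2.2.2 _ hv'
      have hev : e (e⁻¹ v) = v := Equiv.apply_symm_apply _ _
      rwa [← he, ← he, hev] at h
    · apply Subtype.ext
      funext v
      simp [he]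

instance (t : RTree) : Finite t.IncLabelling := by
  choose e he using @exists_enum_of_incLabelling t
  refine Finite.of_injective e fun f g h => Subtype.ext (funext fun v => ?_)
  rw [← he, ← he, h]

/-- In a tree with at least two vertices, the largest label sits on a leaf. -/
theorem exists_leaf_label_eq {t : RTree} (ht : 0 < t.n) (f : t.IncLabelling) :
    ∃ v : t.leaves, f.1 v = t.n := by
  obtain ⟨e, he⟩ := exists_enum_of_incLabelling f
  have hv : f.1 (e⁻¹ (Fin.last _)) = t.n := by rw [← he]; simp
  refine ⟨⟨e⁻¹ (Fin.last _), ?_⟩, hv⟩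
  simp only [leaves, Finset.mem_filter, Finset.mem_univ, true_and]
  refine ⟨fun h => ?_, fun w hw => ?_⟩
  · rw [h, f.2.2.2.1] at hv
    omega
  · by_contra hne
    by_cases h0 : w = 0
    · rw [h0, t.parent_root] at hw
      exact hne (h0.trans hw)
    · have h1 := f.2.2.2.2 w h0
      rw [hw, hv] at h1
      exact absurd (f.2.2.1 w) (by omega)

/-- Labellings whose largest label sits on the leaf `ℓ` are the labellings of the tree
with `ℓ` removed. -/
theorem card_incLabelling_of_leafRemoval {t t' : RTree} {ℓ : Fin (t.n + 1)}
    (h : t.IsLeafRemoval ℓ t') :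
    Nat.card {f : t.IncLabelling // f.1 ℓ = t.n} = Nat.card t'.IncLabelling := by
  obtain ⟨hl, e, he0, hrange, he⟩ := h
  simp only [leaves, Finset.mem_filter, Finset.mem_univ, true_and] at hl
  obtain ⟨hl0, hl⟩ := hl
  have hne (w) : e w ≠ ℓ := by
    have : e w ∈ Set.range e := ⟨w, rfl⟩
    rwa [hrange] at this
  have hex (v) (hv : v ≠ ℓ) : ∃ w, e w = v := by
    have : v ∈ Set.range e := by rw [hrange]; exact hv
    exact this
  have hn : t.n = t'.n + 1 := by
    have h1 := Set.ncard_range_of_injective e.injective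
    have h2 : {u | u ≠ ℓ} = ({ℓ} : Set (Fin (t.n + 1)))ᶜ := rfl
    rw [hrange, h2, Set.ncard_compl] at h1
    simpa using h1
  have he_ne {w} (hw : w ≠ 0) : e w ≠ 0 := fun h => hw (e.injective (h.trans he0.symm))
  refine Nat.card_eq_of_bijective
    (fun f : {f : t.IncLabelling // f.1 ℓ = t.n} =>
      (⟨fun w => f.1.1 (e w), ?_, ?_, ?_, ?_⟩ : t'.IncLabelling)) ⟨?_, ?_⟩
  · exact f.1.2.1.comp e.injective
  · intro w
    have h1 := f.1.2.2.1 (e w)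
    have h2 : f.1.1 (e w) ≠ t.n := fun h => hne w (f.1.2.1 (h.trans f.2.symm))
    change f.1.1 (e w) ≤ t'.n
    omega
  · simp only [he0, f.1.2.2.2.1]
  · intro w hw
    simp only [← he]
    exact f.1.2.2.2.2 _ (he_ne hw)
  · rintro ⟨f, hf⟩ ⟨g, hg⟩ h
    have h' := congrArg Subtype.val h
    apply Subtype.ext
    apply Subtype.ext
    funext v
    by_cases hv : v = ℓ
    · subst hv
      exact hf.trans hg.symm
    · obtain ⟨w, rfl⟩ := hex v hv
      exact congrFun h' w
  · intro f
    let F : Fin (t.n + 1) → ℕ := Function.extend e f.1 fun _ => t.n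
    have hF (w) : F (e w) = f.1 w := e.injective.extend_apply _ _ _
    have hFl : F ℓ = t.n := Function.extend_apply' _ _ _ fun ⟨w, hw⟩ => hne w hw
    have hlt (w) : f.1 w < t.n := by
      have := f.2.2.1 w
      omega
    refine ⟨⟨⟨F, ?_, ?_, ?_, ?_⟩, hFl⟩, Subtype.ext (funext hF)⟩
    · intro v w hvw
      by_cases hv : v = ℓ <;> by_cases hw : w = ℓ
      · rw [hv, hw]
      · obtain ⟨w, rfl⟩ := hex w hw
        rw [hv, hFl, hF] at hvw
        exact absurd (hlt w) (by omega)
      · obtain ⟨v, rfl⟩ := hex v hv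
        rw [hw, hFl, hF] at hvw
        exact absurd (hlt v) (by omega)
      · obtain ⟨v, rfl⟩ := hex v hv
        obtain ⟨w, rfl⟩ := hex w hw
        rw [hF, hF] at hvw
        rw [f.2.1 hvw]
    · intro v
      by_cases hv : v = ℓ
      · rw [hv, hFl]
      · obtain ⟨v, rfl⟩ := hex v hv
        rw [hF]
        exact (hlt v).le
    · rw [← he0, hF, f.2.2.2.1]
    · intro v hv
      by_cases hvl : v = ℓ
      · obtain ⟨w, hw⟩ := hex (t.parent v) fun h => by
          have hfix : t.parent ℓ = ℓ := hvl ▸ h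
          have := t.reaches_root ℓ
          rw [Function.iterate_fixed hfix] at this
          exact hl0 this
        rw [← hw, hF, hvl, hFl]
        exact hlt w
      · obtain ⟨w, rfl⟩ := hex v hvl
        rw [he, hF, hF]
        refine f.2.2.2.2 w fun h => hv ?_
        rw [h, he0]

end RTree

/-- For a rooted tree `τ` with at least two vertices,
`σ(τ)·CM(τ) = Σ_{τ' ∈ T⁻(τ)} σ(τ')·CM(τ')`, where `T⁻(τ)` consists of the trees
obtained from `τ` by removing one leaf together with its edge (one resulting tree
for each leaf of `τ`, each counted once). -/
theorem stmt0 (t : RTree) (ht : 0 < t.n)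
    (r : (ℓ : Fin (t.n + 1)) → ℓ ∈ t.leaves → RTree)
    (hr : ∀ ℓ h, t.IsLeafRemoval ℓ (r ℓ h)) :
    t.sigma * t.CM = ∑ ℓ ∈ t.leaves.attach, (r ℓ.1 ℓ.2).sigma * (r ℓ.1 ℓ.2).CM := by
  simp only [← card_incLabelling]
  choose top htop using exists_leaf_label_eq ht
  have hfib (v : t.leaves) :
      Nat.card {f : t.IncLabelling // top f = v} = Nat.card (r v.1 v.2).IncLabelling := by
    rw [← card_incLabelling_of_leafRemoval (hr v.1 v.2)]
    refine Nat.card_congr (Equiv.subtypeEquivRight fun f => ⟨fun h => h ▸ htop f, fun h => ?_⟩)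
    exact Subtype.ext (f.2.1 ((htop f).trans h.symm))
  rw [← Nat.card_congr (Equiv.sigmaFiberEquiv top), Nat.card_sigma]
  simp only [hfib]
  rfl
end

section
/- Let α, β, f: ℝ → ℝ be smooth, u₀ ∈ ℝ, and let L be the operator (Lg)(x) = α(x)g'(x) + ½β(x)²g''(x). Then for every k ≥ 0, (L^k f)(u₀) = Σ_{τ : |τ| = k+1} (|τ|! / (σ_e(τ)·τ!)) · Υ(τ)(u₀), where the sum runs over all (isomorphism classes of) exotic coloured trees of effective size k+1. -/
/-- The two colours for non-root vertices of an exotic coloured tree. -/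
inductive XColour : Type
  | alpha : XColour
  | beta : XColour
  deriving DecidableEq

/-- An exotic coloured tree: a finite non-planar rooted tree with vertex set
`Fin (n+1)`, distinguished (uncoloured) root `0`, edges oriented towards the root
(encoded by the parent map), whose non-root vertices are coloured by `{α, β}`,
together with a fixed perfect pairing `mate` of the β-vertices (the exotic
decoration); in particular the number of β-vertices is even. -/
structure ExoticTree : Type where
  n : ℕ
  parent : Fin (n + 1) → Fin (n + 1)
  colour : Fin (n + 1) → Option XColour
  mate : Fin (n + 1) → Fin (n + 1)
  parent_root : parent 0 = 0
  reaches_root : ∀ v, parent^[n] v = 0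
  colour_root : colour 0 = none
  colour_nonroot : ∀ v, v ≠ 0 → colour v ≠ none
  mate_beta : ∀ v, colour v = some XColour.beta →
      colour (mate v) = some XColour.beta ∧ mate (mate v) = v ∧ mate v ≠ v
  mate_nonbeta : ∀ v, colour v ≠ some XColour.beta → mate v = v

namespace ExoticTree

/-- The number of children (incoming edges) `𝔫(v)` of a vertex. -/
def nChildren (t : ExoticTree) (v : Fin (t.n + 1)) : ℕ :=
  (Finset.univ.filter fun w => t.parent w = v ∧ w ≠ v).card

/-- A vertex is a leaf if it has no children. -/
def IsLeaf (t : ExoticTree) (v : Fin (t.n + 1)) : Prop := ∀ w, t.parent w = v → w = v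

/-- The number of α-vertices. -/
def numAlpha (t : ExoticTree) : ℕ :=
  (Finset.univ.filter fun v : Fin (t.n + 1) => t.colour v = some XColour.alpha).card

/-- The number of β-vertices. -/
def numBeta (t : ExoticTree) : ℕ :=
  (Finset.univ.filter fun v : Fin (t.n + 1) => t.colour v = some XColour.beta).card

/-- The number of β-pairs (each pair represented by its smaller member). -/
def numPairs (t : ExoticTree) : ℕ :=
  (Finset.univ.filter fun v : Fin (t.n + 1) =>
    t.colour v = some XColour.beta ∧ v < t.mate v).card

/-- The effective size `|τ|`: `1` (the root) plus the number of α-vertices plus the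
number of β-pairs. -/
def effSize (t : ExoticTree) : ℕ := 1 + t.numAlpha + t.numPairs

/-- The edge grading `𝔩(τ) = |τ| − 1`. -/
def edgeCount (t : ExoticTree) : ℕ := t.effSize - 1

/-- Isomorphism of exotic coloured trees: a root-preserving bijection of the vertices
commuting with the parent maps and preserving colours and the β-pairings. -/
def Iso (t₁ t₂ : ExoticTree) : Prop :=
  ∃ e : Fin (t₁.n + 1) ≃ Fin (t₂.n + 1), e 0 = 0 ∧
    (∀ v, t₂.parent (e v) = e (t₁.parent v)) ∧
    (∀ v, t₂.colour (e v) = t₁.colour v) ∧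
    (∀ v, t₂.mate (e v) = e (t₁.mate v))

/-- The symmetry factor `σₑ(τ)`: the order of the group of automorphisms (root-preserving
tree automorphisms preserving colours and mapping paired β-vertices to paired
β-vertices). -/
noncomputable def sigmaE (t : ExoticTree) : ℕ :=
  Nat.card {g : Equiv.Perm (Fin (t.n + 1)) //
    g 0 = 0 ∧ (∀ v, t.parent (g v) = g (t.parent v)) ∧
    (∀ v, t.colour (g v) = t.colour v) ∧ (∀ v, t.mate (g v) = g (t.mate v))}


/-- A tree is monotonically labelled (by creation order) if every non-root vertex is
larger than its parent. -/
def IsMonotoneLabelled (t : ExoticTree) : Prop :=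
  ∀ v : Fin (t.n + 1), v ≠ 0 → t.parent v < v

/-- The two members of each β-pair carry consecutive labels (they are created by
consecutive grafting steps). -/
def PairsConsecutive (t : ExoticTree) : Prop :=
  ∀ v, t.colour v = some XColour.beta →
    ((t.mate v : ℕ) = (v : ℕ) + 1 ∨ (v : ℕ) = (t.mate v : ℕ) + 1)

/-- The number of natural-growth sequences producing `t`.  A natural-growth sequence
(starting from the single-root tree, grafting single α-leaves and simultaneous pairs
of paired β-leaves) is recorded by the tree labelled by creation order — an α-leaf is
created in one step and the two paired β-leaves of one simultaneous grafting occupy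
two consecutive labels — together with, for each β-pair, the datum of which of its
two leaves was attached to which of the two (ordered) chosen attachment vertices. -/
noncomputable def numGrowthSeq (t : ExoticTree) : ℕ :=
  2 ^ t.numPairs *
    Nat.card {s : ExoticTree // s.IsMonotoneLabelled ∧ s.PairsConsecutive ∧ Iso s t}

/-- The exotic Connes–Moscovici weight `CM^e(τ)`: the number of natural-growth
sequences producing `τ`, multiplied by `2^{−(number of β-vertices of τ)}`. -/
noncomputable def CMe (t : ExoticTree) : ℚ :=
  (t.numGrowthSeq : ℚ) / 2 ^ t.numBeta

/-- The α-leaves of `t`. -/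
def alphaLeaves (t : ExoticTree) : Finset (Fin (t.n + 1)) :=
  Finset.univ.filter fun v =>
    t.colour v = some XColour.alpha ∧ ∀ w, t.parent w = v → w = v

/-- The β-pairs both of whose members are leaves (each pair represented by its
smaller member). -/
def betaLeafPairs (t : ExoticTree) : Finset (Fin (t.n + 1)) :=
  Finset.univ.filter fun v =>
    t.colour v = some XColour.beta ∧ v < t.mate v ∧
    (∀ w, t.parent w = v → w = v) ∧ (∀ w, t.parent w = t.mate v → w = t.mate v)

/-- `t'` is (a copy of) the exotic coloured tree obtained from `t` by removing the
α-leaf `ℓ` together with its edge. -/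
def IsAlphaLeafRemoval (t : ExoticTree) (ℓ : Fin (t.n + 1)) (t' : ExoticTree) : Prop :=
  t.colour ℓ = some XColour.alpha ∧ t.IsLeaf ℓ ∧
  ∃ e : Fin (t'.n + 1) ↪ Fin (t.n + 1), e 0 = 0 ∧ Set.range e = {u | u ≠ ℓ} ∧
    (∀ w, t.colour (e w) = t'.colour w) ∧
    (∀ w, t.parent (e w) = e (t'.parent w)) ∧
    (∀ w, t.mate (e w) = e (t'.mate w))

/-- `t'` is (a copy of) the exotic coloured tree obtained from `t` by removing the
paired couple of β-leaves `v`, `mate v` together with their edges. -/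
def IsBetaPairLeafRemoval (t : ExoticTree) (v : Fin (t.n + 1)) (t' : ExoticTree) : Prop :=
  t.colour v = some XColour.beta ∧ t.IsLeaf v ∧ t.IsLeaf (t.mate v) ∧
  ∃ e : Fin (t'.n + 1) ↪ Fin (t.n + 1), e 0 = 0 ∧
    Set.range e = {u | u ≠ v ∧ u ≠ t.mate v} ∧
    (∀ w, t.colour (e w) = t'.colour w) ∧
    (∀ w, t.parent (e w) = e (t'.parent w)) ∧
    (∀ w, t.mate (e w) = e (t'.mate w))

/-- The defining property of the exotic tree factorial `τ!`:
`•! = 1` for the single-root tree, and the recursion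
`|τ|/τ! = Σ_{τ' ∈ T_e⁻(τ)} 1/τ'!`, where `T_e⁻(τ)` consists of the exotic coloured
trees obtained from `τ` by removing one α-leaf or one paired couple of β-leaves
(together with their edges). -/
def IsTreeFactorial (fac : ExoticTree → ℚ) : Prop :=
  (∀ t : ExoticTree, t.n = 0 → fac t = 1) ∧
  ∀ t : ExoticTree, 0 < t.n →
    ∀ (rα : (ℓ : Fin (t.n + 1)) → ℓ ∈ t.alphaLeaves → ExoticTree)
      (rβ : (v : Fin (t.n + 1)) → v ∈ t.betaLeafPairs → ExoticTree),
      (∀ ℓ h, t.IsAlphaLeafRemoval ℓ (rα ℓ h)) →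
      (∀ v h, t.IsBetaPairLeafRemoval v (rβ v h)) →
      (t.effSize : ℚ) / fac t =
        (∑ ℓ ∈ t.alphaLeaves.attach, 1 / fac (rα ℓ.1 ℓ.2)) +
        ∑ v ∈ t.betaLeafPairs.attach, 1 / fac (rβ v.1 v.2)

end ExoticTree

open ExoticTree

/-- The elementary differential `Υ(τ)(x) = f^{(n₀)}(x)·∏_{v α-vertex} α^{(𝔫(v))}(x)·
∏_{v β-vertex} β^{(𝔫(v))}(x)`, where `n₀` is the number of children of the root. -/
noncomputable def elemDiff (a b f : ℝ → ℝ) (t : ExoticTree) (x : ℝ) : ℝ :=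
  iteratedDeriv (t.nChildren 0) f x *
    (∏ v ∈ Finset.univ.filter fun v : Fin (t.n + 1) => t.colour v = some XColour.alpha,
      iteratedDeriv (t.nChildren v) a x) *
    ∏ v ∈ Finset.univ.filter fun v : Fin (t.n + 1) => t.colour v = some XColour.beta,
      iteratedDeriv (t.nChildren v) b x

/-- The number of vertices of the given colour added in one growth step. -/
def XColour.arity : XColour → ℕ
  | .alpha => 1
  | .beta => 2

instance : Fintype XColour := ⟨{.alpha, .beta}, fun c => by cases c <;> simp⟩

theorem XColour.sum_univ {M : Type*} [AddCommMonoid M] (g : XColour → M) :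
    ∑ κ, g κ = g .alpha + g .beta :=
  Finset.sum_pair (by decide)

theorem iterate_card_sub_one_eq {V : Type*} [Fintype V] {p : V → V} {r v : V} (hr : p r = r)
    (h : ∃ k, p^[k] v = r) : p^[Fintype.card V - 1] v = r := by
  classical
  have hmin : ∀ j, p^[j] v = r → Nat.find h ≤ j := fun j hj => Nat.find_min' h hj
  have key : ∀ i j, i < j → j ≤ Nat.find h → p^[i] v ≠ p^[j] v := by
    intro i j hij hj he
    have h1 : p^[Nat.find h - j + i] v = r := by
      rw [Function.iterate_add_apply, he, ← Function.iterate_add_apply, Nat.sub_add_cancel hj]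
      exact Nat.find_spec h
    have := hmin _ h1
    omega
  have hinj : Function.Injective fun i : Fin (Nat.find h + 1) => p^[(i : ℕ)] v := by
    intro i j hij
    rcases lt_trichotomy i j with hlt | rfl | hlt
    · exact absurd hij (key _ _ hlt (by omega))
    · rfl
    · exact absurd hij.symm (key _ _ hlt (by omega))
  have hc := Fintype.card_le_of_injective _ hinj
  rw [Fintype.card_fin] at hc
  obtain ⟨d, hd⟩ := Nat.exists_eq_add_of_le (show Nat.find h ≤ Fintype.card V - 1 by omega)
  rw [hd, add_comm, Function.iterate_add_apply, Nat.find_spec h]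
  exact Function.iterate_fixed hr d

namespace ExoticTree

theorem parent_ne (t : ExoticTree) {v : Fin (t.n + 1)} (hv : v ≠ 0) : t.parent v ≠ v := fun h =>
  hv (by rw [← t.reaches_root v, Function.iterate_fixed h])

theorem mate_mate (t : ExoticTree) (v : Fin (t.n + 1)) : t.mate (t.mate v) = v := by
  by_cases h : t.colour v = some .beta
  · exact (t.mate_beta v h).2.1
  · rw [t.mate_nonbeta v h, t.mate_nonbeta v h]

theorem ne_zero_of_colour {t : ExoticTree} {v : Fin (t.n + 1)} {κ : XColour}
    (h : t.colour v = some κ) : v ≠ 0 := by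
  rintro rfl
  simp [t.colour_root] at h

/-- An exotic tree structure on an arbitrary finite type can be transported to an
`ExoticTree`. -/
theorem exists_equiv_of_fintype {V : Type*} [Fintype V] (r : V) (p : V → V)
    (c : V → Option XColour) (μ : V → V) (hpr : p r = r) (hreach : ∀ v, ∃ k, p^[k] v = r)
    (hcr : c r = none) (hc : ∀ v, v ≠ r → c v ≠ none)
    (hμ : ∀ v, c v = some .beta → c (μ v) = some .beta ∧ μ (μ v) = v ∧ μ v ≠ v)
    (hμ' : ∀ v, c v ≠ some .beta → μ v = v) :
    ∃ (t : ExoticTree) (e : Fin (t.n + 1) ≃ V), e 0 = r ∧ (∀ v, e (t.parent v) = p (e v)) ∧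
      (∀ v, t.colour v = c (e v)) ∧ ∀ v, e (t.mate v) = μ (e v) := by
  classical
  have hpos : 0 < Fintype.card V := Fintype.card_pos_iff.2 ⟨r⟩
  obtain ⟨N, hN⟩ : ∃ N, Fintype.card V = N + 1 := ⟨_, (Nat.sub_add_cancel hpos).symm⟩
  obtain ⟨e, he⟩ : ∃ e : Fin (N + 1) ≃ V, e 0 = r :=
    ⟨(Equiv.swap 0 (Fintype.equivFinOfCardEq hN r)).trans (Fintype.equivFinOfCardEq hN).symm,
      by simp⟩
  have he' : ∀ v, e v = r ↔ v = 0 := fun v => by rw [← he, e.apply_eq_iff_eq]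
  have hsymm : e.symm r = 0 := by rw [← he, e.symm_apply_apply]
  refine ⟨{ n := N
            parent := fun v => e.symm (p (e v))
            colour := fun v => c (e v)
            mate := fun v => e.symm (μ (e v))
            parent_root := by rw [he, hpr, hsymm]
            reaches_root := fun v => ?_
            colour_root := by rw [he, hcr]
            colour_nonroot := fun v hv => hc _ (by rwa [Ne, he'])
            mate_beta := fun v hv => ?_
            mate_nonbeta := fun v hv => by rw [hμ' _ hv, e.symm_apply_apply] },
    e, he, by simp, by simp, by simp⟩
  · have hs : Function.Semiconj e.symm p (fun v => e.symm (p (e v))) := fun x => by simp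
    have := (hs.iterate_right N) (e v)
    rw [e.symm_apply_apply] at this
    rw [← this, ← hsymm]
    have h2 := iterate_card_sub_one_eq hpr (hreach (e v))
    rw [hN, Nat.add_sub_cancel] at h2
    rw [h2]
  · obtain ⟨h1, h2, h3⟩ := hμ _ hv
    refine ⟨by simpa using h1, by simp [h2], ?_⟩
    rwa [Ne, e.symm_apply_eq]

/-- `e` exhibits `t` as the tree obtained from `s` by attaching new leaves of colour `κ`
(one α-leaf, or two paired β-leaves) to the vertices `vs`. -/
structure IsGraft (s : ExoticTree) (κ : XColour) (vs : Fin κ.arity → Fin (s.n + 1))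
    (t : ExoticTree) (e : Fin (s.n + 1) ⊕ Fin κ.arity ≃ Fin (t.n + 1)) : Prop where
  root : e (.inl 0) = 0
  parent_inl : ∀ u, t.parent (e (.inl u)) = e (.inl (s.parent u))
  parent_inr : ∀ i, t.parent (e (.inr i)) = e (.inl (vs i))
  colour_inl : ∀ u, t.colour (e (.inl u)) = s.colour u
  colour_inr : ∀ i, t.colour (e (.inr i)) = some κ
  mate_inl : ∀ u, t.mate (e (.inl u)) = e (.inl (s.mate u))
  mate_inr : ∀ i, t.mate (e (.inr i)) = e (.inr i.rev)

/-- The vertices `ls` are the leaves removed from `t` in one pruning step of colour `κ`,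
a β-pair being taken with an order. -/
structure IsPrunable (t : ExoticTree) (κ : XColour) (ls : Fin κ.arity → Fin (t.n + 1)) :
    Prop where
  injective : Function.Injective ls
  colour : ∀ i, t.colour (ls i) = some κ
  isLeaf : ∀ i, t.IsLeaf (ls i)
  mate : ∀ i, t.mate (ls i) = ls i.rev

theorem exists_isGraft (s : ExoticTree) (κ : XColour) (vs : Fin κ.arity → Fin (s.n + 1)) :
    ∃ t e, IsGraft s κ vs t e := by
  obtain ⟨t, e, h0, hp, hc, hm⟩ := exists_equiv_of_fintype
    (V := Fin (s.n + 1) ⊕ Fin κ.arity) (.inl 0)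
    (Sum.elim (fun u => .inl (s.parent u)) (fun i => .inl (vs i)))
    (Sum.elim s.colour (fun _ => some κ))
    (Sum.elim (fun u => .inl (s.mate u)) (fun i => .inr i.rev))
    (by simp [s.parent_root])
    (by
      have hl : ∀ u : Fin (s.n + 1), (Sum.elim (fun u => Sum.inl (s.parent u))
          (fun i => Sum.inl (vs i)))^[s.n] (Sum.inl u : Fin (s.n + 1) ⊕ Fin κ.arity)
          = Sum.inl 0 := by
        intro u
        have hs : Function.Semiconj (Sum.inl : _ → Fin (s.n + 1) ⊕ Fin κ.arity) s.parent
            (Sum.elim (fun u => Sum.inl (s.parent u)) (fun i => Sum.inl (vs i))) := fun x => rfl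
        rw [← (hs.iterate_right s.n) u, s.reaches_root]
      rintro (u | i)
      · exact ⟨_, hl u⟩
      · exact ⟨s.n + 1, by rw [Function.iterate_succ_apply]; exact hl (vs i)⟩)
    (by simp [s.colour_root])
    (by
      rintro (u | i)
      · simpa using s.colour_nonroot u
      · simp)
    (by
      rintro (u | i)
      · simpa using s.mate_beta u
      · intro h
        obtain rfl : κ = .beta := by simpa using h
        have hrev : ∀ i : Fin 2, i.rev ≠ i := by decide
        exact ⟨by simp, by simp, fun h' => hrev i (Sum.inr_injective h')⟩)
    (by
      rintro (u | i)
      · simpa using s.mate_nonbeta u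
      · intro h
        obtain rfl : κ = .alpha := by
          cases κ
          · rfl
          · simp at h
        simp only [Sum.elim_inr, Sum.inr.injEq]
        exact Subsingleton.elim (α := Fin 1) _ _)
  refine ⟨t, e.symm, ⟨by rw [← h0, e.symm_apply_apply], fun u => ?_, fun u => ?_, fun u => ?_,
    fun u => ?_, fun u => ?_, fun u => ?_⟩⟩
  · rw [Equiv.eq_symm_apply, hp]; simp
  · rw [Equiv.eq_symm_apply, hp]; simp
  · rw [hc]; simp
  · rw [hc]; simp
  · rw [Equiv.eq_symm_apply, hm]; simp
  · rw [Equiv.eq_symm_apply, hm]; simp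

theorem IsPrunable.exists_isGraft {t : ExoticTree} {κ : XColour}
    {ls : Fin κ.arity → Fin (t.n + 1)} (h : IsPrunable t κ ls) :
    ∃ s vs e, IsGraft s κ vs t e ∧ ∀ i, e (.inr i) = ls i := by
  classical
  have hp : ∀ u, (∀ i, ls i ≠ u) → ∀ i, ls i ≠ t.parent u :=
    fun u hu i hi => hu i (h.isLeaf i u hi.symm).symm
  have hm : ∀ u, (∀ i, ls i ≠ u) → ∀ i, ls i ≠ t.mate u := fun u hu i hi =>
    hu i.rev (by rw [← h.mate, hi, t.mate_mate])
  have h0 : ∀ i, ls i ≠ 0 := fun i => ne_zero_of_colour (h.colour i)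
  obtain ⟨s, e, he0, hep, hec, hem⟩ := exists_equiv_of_fintype
    (V := {u : Fin (t.n + 1) // ∀ i, ls i ≠ u}) ⟨0, h0⟩
    (fun u => ⟨t.parent u, hp u u.2⟩) (fun u => t.colour u) (fun u => ⟨t.mate u, hm u u.2⟩)
    (by simp [t.parent_root])
    (by
      intro u
      refine ⟨t.n, Subtype.ext ?_⟩
      have hs : Function.Semiconj (Subtype.val : {u : Fin (t.n + 1) // ∀ i, ls i ≠ u} → _)
        (fun u => ⟨t.parent u, hp u u.2⟩) t.parent := fun x => rfl
      rw [(hs.iterate_right t.n) u, t.reaches_root])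
    t.colour_root
    (fun v hv => t.colour_nonroot v fun h' => hv (Subtype.ext h'))
    (fun v hv => by
      obtain ⟨h1, h2, h3⟩ := t.mate_beta v hv
      exact ⟨h1, Subtype.ext h2, fun h' => h3 (congrArg Subtype.val h')⟩)
    (fun v hv => Subtype.ext (t.mate_nonbeta v hv))
  have hpl : ∀ i j, ls j ≠ t.parent (ls i) := fun i j hj => by
    have := h.isLeaf j (ls i) hj.symm
    exact t.parent_ne (h0 i) (hj.symm.trans this.symm)
  have hbij : Function.Bijective (Sum.elim (fun u => (e u : Fin (t.n + 1))) ls) := by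
    constructor
    · refine Function.Injective.sumElim (Subtype.val_injective.comp e.injective) h.injective ?_
      exact fun u i hi => (e u).2 i hi.symm
    · intro v
      by_cases hv : ∃ i, ls i = v
      · obtain ⟨i, hi⟩ := hv
        exact ⟨.inr i, hi⟩
      · push Not at hv
        exact ⟨.inl (e.symm ⟨v, hv⟩), by simp⟩
  refine ⟨s, fun i => e.symm ⟨t.parent (ls i), hpl i⟩, Equiv.ofBijective _ hbij,
    ⟨?_, fun u => ?_, fun i => ?_, fun u => ?_, fun i => ?_, fun u => ?_, fun i => ?_⟩,
    fun i => rfl⟩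
  · simp [he0]
  · simp [hep]
  · simp
  · simp [hec]
  · simp [h.colour]
  · simp [hem]
  · simp [h.mate]

variable {s t : ExoticTree} {κ : XColour} {vs : Fin κ.arity → Fin (s.n + 1)}
  {e : Fin (s.n + 1) ⊕ Fin κ.arity ≃ Fin (t.n + 1)}

theorem IsGraft.isPrunable (h : IsGraft s κ vs t e) :
    IsPrunable t κ fun i => e (.inr i) where
  injective := e.injective.comp Sum.inr_injective
  colour := h.colour_inr
  isLeaf i w hw := by
    obtain ⟨u | j, rfl⟩ := e.surjective w
    · simp [h.parent_inl] at hw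
    · simp [h.parent_inr] at hw
  mate := h.mate_inr

/-- `g` is an isomorphism of exotic trees from `t₁` to `t₂`. -/
def IsIso (t₁ t₂ : ExoticTree) (g : Fin (t₁.n + 1) ≃ Fin (t₂.n + 1)) : Prop :=
  g 0 = 0 ∧ (∀ v, t₂.parent (g v) = g (t₁.parent v)) ∧
    (∀ v, t₂.colour (g v) = t₁.colour v) ∧ ∀ v, t₂.mate (g v) = g (t₁.mate v)

theorem Iso.symm {t₁ t₂ : ExoticTree} (h : Iso t₁ t₂) : Iso t₂ t₁ := by
  obtain ⟨g, h0, hp, hc, hm⟩ := h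
  refine ⟨g.symm, by rw [g.symm_apply_eq, h0], fun v => ?_, fun v => ?_, fun v => ?_⟩ <;>
    obtain ⟨v, rfl⟩ := g.surjective v
  · simp [hp]
  · simp [hc]
  · simp [hm]

theorem Iso.trans {t₁ t₂ t₃ : ExoticTree} (h : Iso t₁ t₂) (h' : Iso t₂ t₃) : Iso t₁ t₃ := by
  obtain ⟨g, h0, hp, hc, hm⟩ := h
  obtain ⟨g', h0', hp', hc', hm'⟩ := h'
  exact ⟨g.trans g', by simp [h0, h0'], by simp [hp, hp'], by simp [hc, hc'],
    by simp [hm, hm']⟩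

theorem Iso.refl (t : ExoticTree) : Iso t t :=
  ⟨Equiv.refl _, rfl, fun _ => rfl, fun _ => rfl, fun _ => rfl⟩

theorem IsGraft.trans_isIso {t' : ExoticTree} {g : Fin (t.n + 1) ≃ Fin (t'.n + 1)}
    (h : IsGraft s κ vs t e) (hg : IsIso t t' g) : IsGraft s κ vs t' (e.trans g) := by
  obtain ⟨h0, hp, hc, hm⟩ := hg
  constructor <;> simp [h0, hp, hc, hm, h.root, h.parent_inl, h.parent_inr, h.colour_inl,
    h.colour_inr, h.mate_inl, h.mate_inr]

theorem IsGraft.congr_left {s' : ExoticTree} {g : Fin (s'.n + 1) ≃ Fin (s.n + 1)}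
    (h : IsGraft s κ vs t e) (hg : IsIso s' s g) :
    IsGraft s' κ (fun i => g.symm (vs i)) t ((g.sumCongr (Equiv.refl _)).trans e) := by
  obtain ⟨h0, hp, hc, hm⟩ := hg
  constructor <;> simp [h0, hp, hc, hm, h.root, h.parent_inl, h.parent_inr, h.colour_inl,
    h.colour_inr, h.mate_inl, h.mate_inr]

theorem IsGraft.isIso {t' : ExoticTree} {e' : Fin (s.n + 1) ⊕ Fin κ.arity ≃ Fin (t'.n + 1)}
    (h : IsGraft s κ vs t e) (h' : IsGraft s κ vs t' e') : IsIso t t' (e.symm.trans e') := by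
  refine ⟨by simp [← h.root, h'.root], fun v => ?_, fun v => ?_, fun v => ?_⟩ <;>
    obtain ⟨u | i, rfl⟩ := e.surjective v
  · simp [h.parent_inl, h'.parent_inl]
  · simp [h.parent_inr, h'.parent_inr]
  · simp [h.colour_inl, h'.colour_inl]
  · simp [h.colour_inr, h'.colour_inr]
  · simp [h.mate_inl, h'.mate_inl]
  · simp [h.mate_inr, h'.mate_inr]

theorem IsGraft.exists_isIso_left {s' : ExoticTree} {vs' : Fin κ.arity → Fin (s'.n + 1)}
    {e' : Fin (s'.n + 1) ⊕ Fin κ.arity ≃ Fin (t.n + 1)} (h : IsGraft s κ vs t e)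
    (h' : IsGraft s' κ vs' t e') (hee : ∀ i, e (.inr i) = e' (.inr i)) :
    ∃ g, IsIso s s' g ∧ ∀ u, e' (.inl (g u)) = e (.inl u) := by
  have aux : ∀ {s s' : ExoticTree} (e : Fin (s.n + 1) ⊕ Fin κ.arity ≃ Fin (t.n + 1))
      (e' : Fin (s'.n + 1) ⊕ Fin κ.arity ≃ Fin (t.n + 1)),
      (∀ i, e (.inr i) = e' (.inr i)) → ∀ u, ∃ u', e' (.inl u') = e (.inl u) := by
    intro s s' e e' hee u
    obtain ⟨u' | i, hu⟩ := e'.surjective (e (.inl u))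
    · exact ⟨u', hu⟩
    · rw [← hee, e.apply_eq_iff_eq] at hu
      simp at hu
  choose g hg using aux e e' hee
  choose g' hg' using aux e' e fun i => (hee i).symm
  have inj : ∀ {u v}, e (.inl u) = e (.inl v) → u = v := fun huv => by simpa using huv
  have inj' : ∀ {u v}, e' (.inl u) = e' (.inl v) → u = v := fun huv => by simpa using huv
  refine ⟨⟨g, g', fun u => inj (by rw [hg', hg]), fun u => inj' (by rw [hg, hg'])⟩,
    ⟨inj' ?_, fun v => inj' ?_, fun v => ?_, fun v => inj' ?_⟩, hg⟩
  · simp [hg, h.root, h'.root]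
  · simp [hg, ← h'.parent_inl, h.parent_inl]
  · simp [← h'.colour_inl, hg, h.colour_inl]
  · simp [hg, ← h'.mate_inl, h.mate_inl]

/-- The graftings of given leaves onto given vertices of `s` with result `t` form a torsor
under the automorphisms of `t`. -/
theorem IsGraft.card_eq_sigmaE (h : IsGraft s κ vs t e) :
    Nat.card {e' // IsGraft s κ vs t e'} = t.sigmaE := by
  refine Nat.card_congr (β := {g // IsIso t t g})
    ⟨fun e' => ⟨_, h.isIso e'.2⟩, fun g => ⟨_, h.trans_isIso g.2⟩, fun e' => ?_, fun g => ?_⟩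
  · ext x; simp
  · ext x; simp

/-- The graftings onto `s` with result `t` and given new leaves form a torsor under the
automorphisms of `s`. -/
theorem IsGraft.card_eq_sigmaE_left (h : IsGraft s κ vs t e) :
    Nat.card {e' : Fin (s.n + 1) ⊕ Fin κ.arity ≃ Fin (t.n + 1) //
      (∃ vs', IsGraft s κ vs' t e') ∧ (fun i => e' (.inr i)) = fun i => e (.inr i)}
      = s.sigmaE := by
  refine (Nat.card_congr (α := {g // IsIso s s g}) (Equiv.ofBijective (fun g =>
    ⟨(g.1.sumCongr (Equiv.refl _)).trans e, ⟨_, h.congr_left g.2⟩, by simp⟩) ⟨?_, ?_⟩)).symm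
  · intro g g' hgg
    ext u : 2
    have := congrArg (fun e' => e'.1 (.inl u)) hgg
    simpa using this
  · rintro ⟨e', ⟨vs', h'⟩, hee⟩
    obtain ⟨g, hg, hgu⟩ := h'.exists_isIso_left h (congrFun hee)
    refine ⟨⟨g, hg⟩, Subtype.ext (Equiv.ext ?_)⟩
    rintro (u | i)
    · simp [hgu]
    · simpa using (congrFun hee i).symm

open Classical in
/-- The number of pairs formed by a choice of attachment vertices in `s` and a grafting of new
leaves on them with result `t`. -/
noncomputable def numGraft (s : ExoticTree) (κ : XColour) (t : ExoticTree) : ℕ :=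
  ∑ vs : Fin κ.arity → Fin (s.n + 1), Nat.card {e // IsGraft s κ vs t e}

open Classical in
theorem numGraft_eq_sum_leaves (s : ExoticTree) (κ : XColour) (t : ExoticTree) :
    numGraft s κ t = ∑ ls : Fin κ.arity → Fin (t.n + 1),
      Nat.card {e : Fin (s.n + 1) ⊕ Fin κ.arity ≃ Fin (t.n + 1) //
        (∃ vs', IsGraft s κ vs' t e) ∧ (fun i => e (.inr i)) = ls} := by
  have h1 : numGraft s κ t = Nat.card {e // ∃ vs, IsGraft s κ vs t e} := by
    rw [numGraft, ← Nat.card_sigma]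
    refine Nat.card_congr (Equiv.ofBijective (fun x => ⟨x.2.1, x.1, x.2.2⟩) ⟨?_, ?_⟩)
    · rintro ⟨vs, e, h⟩ ⟨vs', e', h'⟩ hee
      obtain rfl : e = e' := congrArg Subtype.val hee
      obtain rfl : vs = vs' := by
        ext i : 1
        have := (h.parent_inr i).symm.trans (h'.parent_inr i)
        simpa using this
      rfl
    · rintro ⟨e, vs, h⟩
      exact ⟨⟨vs, e, h⟩, rfl⟩
  rw [h1, ← Nat.card_sigma]
  exact Nat.card_congr
    ⟨fun e => ⟨_, e.1, e.2, rfl⟩, fun x => ⟨x.2.1, x.2.2.1⟩, fun e => rfl,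
      fun ⟨_, e, he, hl⟩ => by subst hl; rfl⟩

theorem numBeta_eq (t : ExoticTree) : t.numBeta = 2 * t.numPairs := by
  have h1 : t.numBeta = t.numPairs + (Finset.univ.filter fun v : Fin (t.n + 1) =>
      t.colour v = some XColour.beta ∧ ¬ v < t.mate v).card := by
    rw [numBeta, numPairs, ← Finset.filter_filter, ← Finset.filter_filter,
      Finset.card_filter_add_card_filter_not]
  have h2 : (Finset.univ.filter fun v : Fin (t.n + 1) =>
      t.colour v = some XColour.beta ∧ ¬ v < t.mate v).card = t.numPairs := by
    refine Finset.card_bij' (fun v _ => t.mate v) (fun v _ => t.mate v) ?_ ?_ ?_ ?_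
    · intro v hv
      simp only [Finset.mem_filter, Finset.mem_univ, true_and, not_lt] at hv ⊢
      obtain ⟨h, -, hne⟩ := t.mate_beta v hv.1
      exact ⟨h, by rw [t.mate_mate]; exact lt_of_le_of_ne hv.2 hne⟩
    · intro v hv
      simp only [Finset.mem_filter, Finset.mem_univ, true_and, not_lt] at hv ⊢
      exact ⟨(t.mate_beta v hv.1).1, by rw [t.mate_mate]; exact hv.2.le⟩
    · exact fun v _ => t.mate_mate v
    · exact fun v _ => t.mate_mate v
  omega

theorem card_vertices (t : ExoticTree) : t.n = t.numAlpha + t.numBeta := by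
  have h := Finset.card_filter_add_card_filter_not (s := (Finset.univ : Finset (Fin (t.n + 1))))
    (fun v => v = 0)
  have h2 : (Finset.univ.filter fun v : Fin (t.n + 1) => ¬ v = 0) =
      (Finset.univ.filter fun v : Fin (t.n + 1) => t.colour v = some XColour.alpha) ∪
      (Finset.univ.filter fun v : Fin (t.n + 1) => t.colour v = some XColour.beta) := by
    ext v
    simp only [Finset.mem_filter, Finset.mem_univ, true_and, Finset.mem_union]
    constructor
    · intro hv
      have := t.colour_nonroot v hv
      rcases hc : t.colour v with _ | _ | _ <;> simp_all
    · rintro (hv | hv) <;> exact ne_zero_of_colour hv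
  rw [h2, Finset.card_union_of_disjoint] at h
  · simp only [numAlpha, numBeta]
    simp [Finset.filter_eq'] at h
    omega
  · rw [Finset.disjoint_filter]
    intro v _ hv
    simp [hv]

theorem IsGraft.effSize_eq (h : IsGraft s κ vs t e) : t.effSize = s.effSize + 1 := by
  have key : ∀ c : XColour,
      (Finset.univ.filter fun v : Fin (t.n + 1) => t.colour v = some c).card =
      (Finset.univ.filter fun v : Fin (s.n + 1) => s.colour v = some c).card +
        if κ = c then κ.arity else 0 := by
    intro c
    simp only [Finset.card_filter]
    rw [← e.sum_comp, Fintype.sum_sum_type]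
    simp [h.colour_inl, h.colour_inr]
  have hα : t.numAlpha = _ := key .alpha
  have hβ : t.numBeta = _ := key .beta
  rw [← numAlpha] at hα
  rw [← numBeta] at hβ
  have := numBeta_eq s
  have := numBeta_eq t
  simp only [effSize]
  cases κ <;> simp [XColour.arity] at hα hβ <;> omega

open Classical in
theorem IsGraft.nChildren_inl (h : IsGraft s κ vs t e) (u : Fin (s.n + 1)) :
    t.nChildren (e (.inl u)) = s.nChildren u + (∑ i, Pi.single (vs i) 1 : Fin (s.n + 1) → ℕ) u := by
  simp only [nChildren, Finset.card_filter]
  rw [← e.sum_comp, Fintype.sum_sum_type]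
  simp [h.parent_inl, h.parent_inr, Pi.single_apply, eq_comm]

theorem IsGraft.nChildren_inr (h : IsGraft s κ vs t e) (i : Fin κ.arity) :
    t.nChildren (e (.inr i)) = 0 := by
  rw [nChildren, Finset.card_eq_zero, Finset.filter_eq_empty_iff]
  rintro w - ⟨h1, h2⟩
  exact h2 (h.isPrunable.isLeaf i w h1)

end ExoticTree

/-- The function attached to a vertex of the given colour in elementary differentials. -/
def vertexField (a b f : ℝ → ℝ) : Option XColour → ℝ → ℝ
  | none => f
  | some .alpha => a
  | some .beta => b

section Calculus

variable {ι : Type*} [Fintype ι]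

/-- The product of the derivatives of order `m v` of the functions `G v`. -/
noncomputable def prodIteratedDeriv (G : ι → ℝ → ℝ) (m : ι → ℕ) (x : ℝ) : ℝ :=
  ∏ v, iteratedDeriv (m v) (G v) x

variable {G : ι → ℝ → ℝ}

theorem contDiff_prodIteratedDeriv (hG : ∀ v, ContDiff ℝ (⊤ : ℕ∞) (G v)) (m : ι → ℕ) :
    ContDiff ℝ (⊤ : ℕ∞) (prodIteratedDeriv G m) := by
  unfold prodIteratedDeriv
  refine contDiff_prod fun v _ => ?_
  rw [iteratedDeriv_eq_iterate]
  exact (hG v).iterate_deriv (m v)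

open Classical in
theorem deriv_prodIteratedDeriv (hG : ∀ v, ContDiff ℝ (⊤ : ℕ∞) (G v)) (m : ι → ℕ) (x : ℝ) :
    deriv (prodIteratedDeriv G m) x = ∑ v, prodIteratedDeriv G (m + Pi.single v 1) x := by
  have h : ∀ v ∈ (Finset.univ : Finset ι), HasDerivAt (iteratedDeriv (m v) (G v))
      (iteratedDeriv (m v + 1) (G v) x) x := by
    intro v _
    rw [iteratedDeriv_succ]
    exact (((hG v).differentiable_iteratedDeriv (m v)
      (by exact_mod_cast ENat.natCast_lt_top (m v))) x).hasDerivAt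
  have h2 := HasDerivAt.fun_finsetProd h
  rw [show prodIteratedDeriv G m = fun x => ∏ v, iteratedDeriv (m v) (G v) x from rfl, h2.deriv]
  refine Finset.sum_congr rfl fun v _ => ?_
  rw [prodIteratedDeriv, ← Finset.prod_erase_mul _ _ (Finset.mem_univ v), smul_eq_mul]
  congr 1
  · refine Finset.prod_congr rfl fun w hw => ?_
    simp [Finset.ne_of_mem_erase hw]
  · simp

open Classical in
theorem iteratedDeriv_prodIteratedDeriv (hG : ∀ v, ContDiff ℝ (⊤ : ℕ∞) (G v)) (j : ℕ) :
    ∀ m : ι → ℕ, iteratedDeriv j (prodIteratedDeriv G m) = fun x =>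
      ∑ vs : Fin j → ι, prodIteratedDeriv G (m + ∑ i, Pi.single (vs i) 1) x := by
  induction j with
  | zero => intro m; ext x; simp
  | succ j ih =>
    intro m
    ext x
    rw [iteratedDeriv_succ, ih, deriv_fun_sum fun vs _ =>
      (contDiff_prodIteratedDeriv hG _).differentiable (by simp) x]
    simp only [deriv_prodIteratedDeriv hG]
    rw [← (Fin.consEquiv fun _ : Fin (j + 1) => ι).sum_comp, Fintype.sum_prod_type_right]
    refine Finset.sum_congr rfl fun vs _ => Finset.sum_congr rfl fun v _ => ?_
    rw [add_assoc, add_comm (∑ i, _)]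
    simp [Fin.sum_univ_succ]

end Calculus

namespace ExoticTree

variable {s t : ExoticTree} {κ : XColour} {vs : Fin κ.arity → Fin (s.n + 1)}
  {e : Fin (s.n + 1) ⊕ Fin κ.arity ≃ Fin (t.n + 1)}

theorem elemDiff_eq (a b f : ℝ → ℝ) (t : ExoticTree) :
    elemDiff a b f t = prodIteratedDeriv (fun v => vertexField a b f (t.colour v)) t.nChildren := by
  ext x
  have h0 : iteratedDeriv (t.nChildren 0) f x =
      ∏ v, if v = 0 then iteratedDeriv (t.nChildren v) f x else 1 := by simp
  rw [elemDiff, prodIteratedDeriv, h0, Finset.prod_filter, Finset.prod_filter,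
    ← Finset.prod_mul_distrib, ← Finset.prod_mul_distrib]
  refine Finset.prod_congr rfl fun v _ => ?_
  by_cases hv : v = 0
  · subst hv
    simp [t.colour_root, vertexField]
  · have := t.colour_nonroot v hv
    rcases hc : t.colour v with _ | _ | _ <;> simp_all [vertexField]

open Classical in
theorem IsGraft.elemDiff_eq (a b f : ℝ → ℝ) (h : IsGraft s κ vs t e) (x : ℝ) :
    elemDiff a b f t x = vertexField a b f (some κ) x ^ κ.arity *
      prodIteratedDeriv (fun v => vertexField a b f (s.colour v))
        (s.nChildren + ∑ i, Pi.single (vs i) 1) x := by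
  rw [ExoticTree.elemDiff_eq, prodIteratedDeriv, prodIteratedDeriv, ← e.prod_comp,
    Fintype.prod_sum_type, mul_comm]
  simp [h.nChildren_inl, h.nChildren_inr, h.colour_inl, h.colour_inr]

theorem sigmaE_pos (t : ExoticTree) : 0 < t.sigmaE := by
  have : Nonempty {g // IsIso t t g} := nonempty_subtype.2 (Iso.refl t)
  exact Nat.card_pos (α := {g // IsIso t t g})

theorem Iso.effSize_eq {t₁ t₂ : ExoticTree} (h : Iso t₁ t₂) : t₁.effSize = t₂.effSize := by
  obtain ⟨g, -, -, hc, -⟩ := h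
  have key : ∀ c : XColour,
      (Finset.univ.filter fun v : Fin (t₁.n + 1) => t₁.colour v = some c).card =
      (Finset.univ.filter fun v : Fin (t₂.n + 1) => t₂.colour v = some c).card := by
    intro c
    simp only [Finset.card_filter]
    rw [← g.sum_comp]
    simp [hc]
  have hα : t₁.numAlpha = t₂.numAlpha := key .alpha
  have hβ : t₁.numBeta = t₂.numBeta := key .beta
  rw [numBeta_eq, numBeta_eq] at hβ
  simp only [effSize]
  omega

theorem finite_n_lt (N : ℕ) : {t : ExoticTree | t.n < N}.Finite := by
  refine Finite.of_injective (β := Σ n : Fin N, (Fin (n + 1) → Fin (n + 1)) ×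
    (Fin (n + 1) → Option XColour) × (Fin (n + 1) → Fin (n + 1)))
    (fun t => ⟨⟨t.1.n, t.2⟩, t.1.parent, t.1.colour, t.1.mate⟩) ?_
  rintro ⟨⟨n, p, c, m, _, _, _, _, _, _⟩, ht⟩ ⟨⟨n', p', c', m', _, _, _, _, _, _⟩, ht'⟩ h
  simp only [Sigma.mk.injEq, Fin.mk.injEq] at h
  obtain ⟨rfl, h⟩ := h
  simp only [heq_eq_eq, Prod.mk.injEq] at h
  obtain ⟨rfl, rfl, rfl⟩ := h
  rfl

theorem finite_effSize_eq (k : ℕ) : {t : ExoticTree | t.effSize = k}.Finite := by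
  refine (finite_n_lt (2 * k + 1)).subset fun t ht => ?_
  have h1 := numBeta_eq t
  have h2 := card_vertices t
  simp only [effSize, Set.mem_ofPred_eq] at ht ⊢
  omega

/-- `S` is a system of representatives of the exotic trees of effective size `k`. -/
structure IsRepSystem (k : ℕ) (S : Finset ExoticTree) : Prop where
  effSize_eq : ∀ τ ∈ S, τ.effSize = k
  eq_of_iso : ∀ τ₁ ∈ S, ∀ τ₂ ∈ S, Iso τ₁ τ₂ → τ₁ = τ₂
  exists_iso : ∀ τ : ExoticTree, τ.effSize = k → ∃ τ' ∈ S, Iso τ τ'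

theorem exists_isRepSystem (k : ℕ) : ∃ S, IsRepSystem k S := by
  classical
  let r : Setoid ExoticTree := ⟨Iso, Iso.refl, Iso.symm, Iso.trans⟩
  have hout : ∀ t : ExoticTree, Iso (Quotient.mk r t).out t := fun t => Quotient.mk_out (s := r) t
  refine ⟨(finite_effSize_eq k).toFinset.image fun t => (Quotient.mk r t).out,
    ?_, ?_, fun τ hτ => ⟨_, Finset.mem_image_of_mem _ (by simpa using hτ), (hout τ).symm⟩⟩
  · intro τ hτ
    obtain ⟨t, ht, rfl⟩ := Finset.mem_image.1 hτ
    rw [(hout t).effSize_eq]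
    simpa using ht
  · intro τ₁ h₁ τ₂ h₂ h
    obtain ⟨t₁, -, rfl⟩ := Finset.mem_image.1 h₁
    obtain ⟨t₂, -, rfl⟩ := Finset.mem_image.1 h₂
    have h12 : Iso t₁ t₂ := ((hout t₁).symm.trans h).trans (hout t₂)
    rw [Quotient.sound (s := r) h12]

theorem IsPrunable.exists_isGraft_mem {k : ℕ} {S : Finset ExoticTree} (hS : IsRepSystem k S)
    (ht : t.effSize = k + 1) {ls : Fin κ.arity → Fin (t.n + 1)} (h : IsPrunable t κ ls) :
    ∃ s ∈ S, ∃ vs e, IsGraft s κ vs t e ∧ ∀ i, e (.inr i) = ls i := by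
  obtain ⟨s, vs, e, hg, hl⟩ := h.exists_isGraft
  have := hg.effSize_eq
  obtain ⟨s', hs', hiso⟩ := hS.exists_iso s (by omega)
  obtain ⟨g, hg'⟩ := hiso.symm
  exact ⟨s', hs', _, _, hg.congr_left hg', by simpa using hl⟩

theorem exists_isGraft_mem {k : ℕ} {S : Finset ExoticTree} (hS : IsRepSystem (k + 1) S)
    (hs : s.effSize = k) (vs : Fin κ.arity → Fin (s.n + 1)) :
    ∃ t ∈ S, ∃ e, IsGraft s κ vs t e := by
  obtain ⟨t, e, hg⟩ := exists_isGraft s κ vs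
  obtain ⟨t', ht', g, hg'⟩ := hS.exists_iso t (by rw [hg.effSize_eq, hs])
  exact ⟨t', ht', _, hg.trans_isIso hg'⟩

theorem IsGraft.isAlphaLeafRemoval {vs : Fin (XColour.arity .alpha) → Fin (s.n + 1)}
    {e : Fin (s.n + 1) ⊕ Fin (XColour.arity .alpha) ≃ Fin (t.n + 1)}
    (h : IsGraft s .alpha vs t e) {v : Fin (t.n + 1)} (hv : ∀ i, e (.inr i) = v) :
    t.IsAlphaLeafRemoval v s := by
  obtain rfl := hv (0 : Fin 1)
  refine ⟨h.colour_inr _, h.isPrunable.isLeaf _,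
    ⟨fun u => e (.inl u), e.injective.comp Sum.inl_injective⟩, h.root, ?_, h.colour_inl,
    h.parent_inl, h.mate_inl⟩
  ext w
  obtain ⟨u | i, rfl⟩ := e.surjective w
  · simp
  · obtain rfl : i = (0 : Fin 1) := Subsingleton.elim (α := Fin 1) _ _
    simp

theorem IsGraft.isBetaPairLeafRemoval {vs : Fin (XColour.arity .beta) → Fin (s.n + 1)}
    {e : Fin (s.n + 1) ⊕ Fin (XColour.arity .beta) ≃ Fin (t.n + 1)}
    (h : IsGraft s .beta vs t e) (i : Fin (XColour.arity .beta)) {v : Fin (t.n + 1)}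
    (hv : e (.inr i) = v) : t.IsBetaPairLeafRemoval v s := by
  subst hv
  refine ⟨h.colour_inr _, h.isPrunable.isLeaf _, ?_,
    ⟨fun u => e (.inl u), e.injective.comp Sum.inl_injective⟩, h.root, ?_, h.colour_inl,
    h.parent_inl, h.mate_inl⟩
  · rw [h.mate_inr]
    exact h.isPrunable.isLeaf i.rev
  · ext w
    rw [h.mate_inr]
    obtain ⟨u | j, rfl⟩ := e.surjective w
    · simp
    · have hij : ∀ i j : Fin 2, j = i ∨ j = i.rev := by decide
      have := hij i j
      simp only [Function.Embedding.coeFn_mk, Set.mem_range, EmbeddingLike.apply_eq_iff_eq,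
        reduceCtorEq, exists_false, Set.mem_ofPred_eq, ne_eq, Sum.inr.injEq, false_iff]
      tauto

/-- The leaf and its mate, as a candidate for a pruning step of colour `β`. -/
def pairLeaves (t : ExoticTree) (v : Fin (t.n + 1)) : Fin (XColour.arity .beta) → Fin (t.n + 1) :=
  ![v, t.mate v]

theorem isPrunable_alpha_iff (t : ExoticTree) (v : Fin (t.n + 1)) :
    IsPrunable t .alpha (fun _ => v) ↔ v ∈ t.alphaLeaves := by
  simp only [alphaLeaves, Finset.mem_filter, Finset.mem_univ, true_and]
  constructor
  · exact fun h => ⟨h.colour (0 : Fin 1), h.isLeaf (0 : Fin 1)⟩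
  · rintro ⟨h1, h2⟩
    exact ⟨fun i j _ => Subsingleton.elim (α := Fin 1) i j, fun _ => h1, fun _ => h2,
      fun _ => t.mate_nonbeta v (by simp [h1])⟩

theorem isPrunable_pairLeaves_iff (t : ExoticTree) (v : Fin (t.n + 1)) :
    IsPrunable t .beta (t.pairLeaves v) ↔
      t.colour v = some .beta ∧ t.IsLeaf v ∧ t.IsLeaf (t.mate v) := by
  constructor
  · exact fun h => ⟨h.colour (0 : Fin 2), h.isLeaf (0 : Fin 2), h.isLeaf (1 : Fin 2)⟩
  · rintro ⟨h1, h2, h3⟩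
    obtain ⟨h4, h5, h6⟩ := t.mate_beta v h1
    refine ⟨?_, ?_, ?_, ?_⟩
    · exact (Fin.cons_injective_iff (n := 1)).2 ⟨by simpa using h6.symm, fun i j _ =>
        Subsingleton.elim i j⟩
    · exact Fin.forall_fin_two.2 ⟨h1, h4⟩
    · exact Fin.forall_fin_two.2 ⟨h2, h3⟩
    · exact Fin.forall_fin_two.2 ⟨rfl, h5⟩

theorem mem_betaLeafPairs_iff (t : ExoticTree) (v : Fin (t.n + 1)) :
    v ∈ t.betaLeafPairs ↔ IsPrunable t .beta (t.pairLeaves v) ∧ v < t.mate v := by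
  rw [isPrunable_pairLeaves_iff]
  simp only [betaLeafPairs, IsLeaf, Finset.mem_filter, Finset.mem_univ, true_and]
  tauto

theorem isPrunable_pairLeaves_mate_iff (t : ExoticTree) (v : Fin (t.n + 1)) :
    IsPrunable t .beta (t.pairLeaves (t.mate v)) ↔ IsPrunable t .beta (t.pairLeaves v) := by
  rw [isPrunable_pairLeaves_iff, isPrunable_pairLeaves_iff, t.mate_mate]
  have h : t.colour (t.mate v) = some .beta ↔ t.colour v = some .beta :=
    ⟨fun h => by simpa [t.mate_mate] using (t.mate_beta _ h).1, fun h => (t.mate_beta _ h).1⟩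
  rw [h]
  tauto

theorem sum_arity_alpha {ι M : Type*} [Fintype ι] [AddCommMonoid M]
    (g : (Fin (XColour.arity .alpha) → ι) → M) : ∑ ls, g ls = ∑ v, g fun _ => v :=
  ((Equiv.funUnique (Fin 1) ι).symm.sum_comp g).symm

theorem sum_arity_beta {ι M : Type*} [Fintype ι] [AddCommMonoid M]
    (g : (Fin (XColour.arity .beta) → ι) → M) :
    ∑ ls, g ls = ∑ v, ∑ w, g (![v, w] : Fin 2 → ι) :=
  ((finTwoArrowEquiv ι).symm.sum_comp g).symm.trans (Fintype.sum_prod_type _)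

open Classical in
theorem sum_isPrunable_alpha {M : Type*} [AddCommMonoid M]
    (g : (Fin (XColour.arity .alpha) → Fin (t.n + 1)) → M) :
    (∑ ls, if IsPrunable t .alpha ls then g ls else 0) = ∑ v ∈ t.alphaLeaves, g fun _ => v := by
  rw [sum_arity_alpha, ← Finset.sum_filter]
  simp [isPrunable_alpha_iff]

open Classical in
theorem sum_isPrunable_beta {M : Type*} [AddCommMonoid M]
    (g : (Fin (XColour.arity .beta) → Fin (t.n + 1)) → M) :
    (∑ ls, if IsPrunable t .beta ls then g ls else 0) =
      ∑ v ∈ t.betaLeafPairs, g (t.pairLeaves v) +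
      ∑ v ∈ t.betaLeafPairs, g (t.pairLeaves (t.mate v)) := by
  have hl : (∑ ls, if IsPrunable t .beta ls then g ls else 0) =
      ∑ v, if IsPrunable t .beta (t.pairLeaves v) then g (t.pairLeaves v) else 0 := by
    rw [sum_arity_beta]
    refine Finset.sum_congr rfl fun v _ => ?_
    rw [Fintype.sum_eq_single (t.mate v)]
    · rfl
    · intro w hw
      exact if_neg fun h => hw (h.mate (0 : Fin 2)).symm
  have h2 : ∀ v, (if IsPrunable t .beta (t.pairLeaves v) then g (t.pairLeaves v) else 0) =
      (if v ∈ t.betaLeafPairs then g (t.pairLeaves v) else 0) +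
      if t.mate v ∈ t.betaLeafPairs then g (t.pairLeaves v) else 0 := by
    intro v
    simp only [mem_betaLeafPairs_iff, isPrunable_pairLeaves_mate_iff, t.mate_mate]
    by_cases hv : IsPrunable t .beta (t.pairLeaves v)
    · have hne := (t.mate_beta v ((isPrunable_pairLeaves_iff t v).1 hv).1).2.2
      rcases lt_or_gt_of_ne hne with h | h <;> simp [hv, h, h.not_gt]
    · simp [hv]
  rw [hl, Finset.sum_congr rfl fun v _ => h2 v, Finset.sum_add_distrib]
  congr 1
  · simp
  · have hinv : Function.Involutive t.mate := t.mate_mate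
    rw [← Equiv.sum_comp hinv.toPerm]
    simp [t.mate_mate]

/-- The quotient of the factorial of the effective size by the value of `fac`. -/
noncomputable def facWeight (fac : ExoticTree → ℚ) (t : ExoticTree) : ℝ :=
  (Nat.factorial t.effSize : ℝ) / ((fac t : ℚ) : ℝ)

open Classical in
theorem facWeight_eq_sum {fac : ExoticTree → ℚ} (hfac : IsTreeFactorial fac) {k : ℕ}
    (ht : t.effSize = k + 2)
    (R : (κ : XColour) → (Fin κ.arity → Fin (t.n + 1)) → ExoticTree)
    (hR : ∀ κ ls, IsPrunable t κ ls →
      ∃ vs e, IsGraft (R κ ls) κ vs t e ∧ ∀ i, e (.inr i) = ls i) :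
    facWeight fac t = ∑ κ : XColour, (κ.arity.factorial : ℝ)⁻¹ *
      ∑ ls, if IsPrunable t κ ls then facWeight fac (R κ ls) else 0 := by
  have hn : 0 < t.n := by
    have h1 := numBeta_eq t
    have h2 := card_vertices t
    simp only [effSize] at ht
    omega
  have hα : ∀ v ∈ t.alphaLeaves, t.IsAlphaLeafRemoval v (R .alpha fun _ => v) := by
    intro v hv
    obtain ⟨vs, e, hg, hl⟩ := hR .alpha _ ((isPrunable_alpha_iff t v).2 hv)
    exact hg.isAlphaLeafRemoval hl
  have hβ : ∀ v ∈ t.betaLeafPairs, t.IsBetaPairLeafRemoval v (R .beta (t.pairLeaves v)) := by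
    intro v hv
    obtain ⟨vs, e, hg, hl⟩ := hR .beta _ ((mem_betaLeafPairs_iff t v).1 hv).1
    exact hg.isBetaPairLeafRemoval (0 : Fin 2) (hl (0 : Fin 2))
  have hβ' : ∀ v ∈ t.betaLeafPairs,
      t.IsBetaPairLeafRemoval v (R .beta (t.pairLeaves (t.mate v))) := by
    intro v hv
    obtain ⟨vs, e, hg, hl⟩ := hR .beta _
      ((isPrunable_pairLeaves_mate_iff t v).2 ((mem_betaLeafPairs_iff t v).1 hv).1)
    exact hg.isBetaPairLeafRemoval (1 : Fin 2) ((hl (1 : Fin 2)).trans (t.mate_mate v))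
  have e1 := hfac.2 t hn (fun v _ => R .alpha fun _ => v) (fun v _ => R .beta (t.pairLeaves v))
    hα hβ
  have e2 := hfac.2 t hn (fun v _ => R .alpha fun _ => v)
    (fun v _ => R .beta (t.pairLeaves (t.mate v))) hα hβ'
  rw [Finset.sum_attach t.alphaLeaves fun v => 1 / fac (R .alpha fun _ => v)] at e1 e2
  rw [Finset.sum_attach t.betaLeafPairs fun v => 1 / fac (R .beta (t.pairLeaves v))] at e1
  rw [Finset.sum_attach t.betaLeafPairs
    fun v => 1 / fac (R .beta (t.pairLeaves (t.mate v)))] at e2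
  have hw : ∀ κ ls, IsPrunable t κ ls →
      facWeight fac (R κ ls) = ((k + 1).factorial : ℝ) * ((1 / fac (R κ ls) : ℚ) : ℝ) := by
    intro κ ls h
    obtain ⟨vs, e, hg, -⟩ := hR κ ls h
    have : (R κ ls).effSize = k + 1 := by
      have := hg.effSize_eq
      omega
    rw [facWeight, this]
    push_cast
    ring
  have hsum : ∀ κ, (∑ ls, if IsPrunable t κ ls then facWeight fac (R κ ls) else 0) =
      ((k + 1).factorial : ℝ) *
        ((∑ ls, if IsPrunable t κ ls then 1 / fac (R κ ls) else 0 : ℚ) : ℝ) := by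
    intro κ
    rw [Rat.cast_sum, Finset.mul_sum]
    refine Finset.sum_congr rfl fun ls _ => ?_
    split_ifs with h
    · exact hw κ ls h
    · simp
  have hmain : (t.effSize : ℚ) / fac t =
      ∑ κ : XColour, (κ.arity.factorial : ℚ)⁻¹ *
        ∑ ls, if IsPrunable t κ ls then 1 / fac (R κ ls) else 0 := by
    rw [XColour.sum_univ, sum_isPrunable_alpha, sum_isPrunable_beta,
      show (XColour.arity .alpha).factorial = 1 from rfl,
      show (XColour.arity .beta).factorial = 2 from rfl]
    push_cast
    linarith
  have hcast := congrArg (fun q : ℚ => ((k + 1).factorial : ℝ) * (q : ℝ)) hmain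
  simp only [Rat.cast_div, Rat.cast_natCast, Rat.cast_sum (s := (Finset.univ : Finset XColour)),
    Rat.cast_mul, Rat.cast_inv] at hcast
  simp only [hsum]
  rw [facWeight, ht, show k + 2 = (k + 1) + 1 from rfl, Nat.factorial_succ]
  rw [ht, Finset.mul_sum] at hcast
  push_cast at hcast ⊢
  rw [mul_comm (_ + 1 + 1 : ℝ), mul_div_assoc, add_assoc (k : ℝ), one_add_one_eq_two]
  refine hcast.trans (Finset.sum_congr rfl fun κ _ => ?_)
  ring

open Classical in
theorem sum_card_isPrunable {k : ℕ} {S : Finset ExoticTree} (hS : IsRepSystem k S)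
    {ls : Fin κ.arity → Fin (t.n + 1)} {r : ExoticTree} (c : ExoticTree → ℝ)
    (hr : IsPrunable t κ ls → r ∈ S ∧ ∃ vs e, IsGraft r κ vs t e ∧ ∀ i, e (.inr i) = ls i) :
    (∑ s ∈ S, c s / s.sigmaE * Nat.card {e : Fin (s.n + 1) ⊕ Fin κ.arity ≃ Fin (t.n + 1) //
      (∃ vs', IsGraft s κ vs' t e) ∧ (fun i => e (.inr i)) = ls}) =
      if IsPrunable t κ ls then c r else 0 := by
  split_ifs with h
  · obtain ⟨hrS, vs, e, hg, hl⟩ := hr h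
    obtain rfl : (fun i => e (.inr i)) = ls := funext hl
    rw [Finset.sum_eq_single_of_mem r hrS, hg.card_eq_sigmaE_left]
    · exact div_mul_cancel₀ _ (by exact_mod_cast (sigmaE_pos r).ne')
    · intro s hs hsr
      have : IsEmpty {e' : Fin (s.n + 1) ⊕ Fin κ.arity ≃ Fin (t.n + 1) //
          (∃ vs', IsGraft s κ vs' t e') ∧ (fun i => e' (.inr i)) = fun i => e (.inr i)} := by
        rw [isEmpty_subtype]
        rintro e' ⟨⟨vs', hg'⟩, hl'⟩
        obtain ⟨g, hgi, -⟩ := hg'.exists_isIso_left hg (congrFun hl')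
        exact hsr (hS.eq_of_iso s hs r hrS ⟨g, hgi⟩)
      simp
  · refine Finset.sum_eq_zero fun s _ => ?_
    have : IsEmpty {e' : Fin (s.n + 1) ⊕ Fin κ.arity ≃ Fin (t.n + 1) //
        (∃ vs', IsGraft s κ vs' t e') ∧ (fun i => e' (.inr i)) = ls} := by
      rw [isEmpty_subtype]
      rintro e' ⟨⟨vs', hg'⟩, rfl⟩
      exact h hg'.isPrunable
    simp

/-- The weight of a tree in terms of those of its prunings. -/
theorem facWeight_eq_sum_numGraft {fac : ExoticTree → ℚ} (hfac : IsTreeFactorial fac) {k : ℕ}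
    {S : Finset ExoticTree} (hS : IsRepSystem (k + 1) S) (ht : t.effSize = k + 2) :
    facWeight fac t = ∑ s ∈ S, facWeight fac s / s.sigmaE *
      ∑ κ : XColour, (κ.arity.factorial : ℝ)⁻¹ * numGraft s κ t := by
  classical
  have hex : ∀ (κ : XColour) (ls : Fin κ.arity → Fin (t.n + 1)), ∃ r, IsPrunable t κ ls →
      r ∈ S ∧ ∃ vs e, IsGraft r κ vs t e ∧ ∀ i, e (.inr i) = ls i := by
    intro κ ls
    by_cases h : IsPrunable t κ ls
    · obtain ⟨r, hr, hg⟩ := h.exists_isGraft_mem hS ht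
      exact ⟨r, fun _ => ⟨hr, hg⟩⟩
    · exact ⟨t, fun h' => absurd h' h⟩
  choose R hR using hex
  rw [facWeight_eq_sum hfac ht R fun κ ls h => (hR κ ls h).2]
  simp only [Finset.mul_sum]
  rw [Finset.sum_comm]
  refine Finset.sum_congr rfl fun κ _ => ?_
  simp only [numGraft_eq_sum_leaves, Nat.cast_sum, Finset.mul_sum]
  rw [Finset.sum_comm]
  refine Finset.sum_congr rfl fun ls _ => ?_
  rw [← sum_card_isPrunable hS (facWeight fac) (hR κ ls), Finset.mul_sum]
  exact Finset.sum_congr rfl fun s _ => by ring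

theorem contDiff_vertexField {a b f : ℝ → ℝ} (ha : ContDiff ℝ (⊤ : ℕ∞) a)
    (hb : ContDiff ℝ (⊤ : ℕ∞) b) (hf : ContDiff ℝ (⊤ : ℕ∞) f) :
    ∀ c, ContDiff ℝ (⊤ : ℕ∞) (vertexField a b f c)
  | none => hf
  | some .alpha => ha
  | some .beta => hb

/-- Differentiating the elementary differential of `s` grafts leaves on its vertices. -/
theorem pow_mul_iteratedDeriv_elemDiff {a b f : ℝ → ℝ} (ha : ContDiff ℝ (⊤ : ℕ∞) a)
    (hb : ContDiff ℝ (⊤ : ℕ∞) b) (hf : ContDiff ℝ (⊤ : ℕ∞) f) {k : ℕ} {S : Finset ExoticTree}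
    (hS : IsRepSystem (k + 1) S) (hs : s.effSize = k) (κ : XColour) (x : ℝ) :
    vertexField a b f (some κ) x ^ κ.arity * iteratedDeriv κ.arity (elemDiff a b f s) x =
      ∑ t ∈ S, elemDiff a b f t x / t.sigmaE * numGraft s κ t := by
  classical
  rw [elemDiff_eq, iteratedDeriv_prodIteratedDeriv fun v => contDiff_vertexField ha hb hf _]
  simp only [numGraft, Nat.cast_sum, Finset.mul_sum]
  rw [Finset.sum_comm]
  refine Finset.sum_congr rfl fun vs _ => ?_
  obtain ⟨t, ht, e, hg⟩ := exists_isGraft_mem hS hs vs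
  rw [Finset.sum_eq_single_of_mem t ht, hg.card_eq_sigmaE,
    div_mul_cancel₀ _ (by exact_mod_cast (sigmaE_pos t).ne'), hg.elemDiff_eq]
  · congr!
  · intro t' ht' hne
    have : IsEmpty {e // IsGraft s κ vs t' e} := by
      rw [isEmpty_subtype]
      intro e' hg'
      exact hne (hS.eq_of_iso t' ht' t ht ⟨_, hg'.isIso hg⟩)
    simp

theorem contDiff_elemDiff {a b f : ℝ → ℝ} (ha : ContDiff ℝ (⊤ : ℕ∞) a)
    (hb : ContDiff ℝ (⊤ : ℕ∞) b) (hf : ContDiff ℝ (⊤ : ℕ∞) f) (t : ExoticTree) :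
    ContDiff ℝ (⊤ : ℕ∞) (elemDiff a b f t) := by
  rw [elemDiff_eq]
  exact contDiff_prodIteratedDeriv (fun v => contDiff_vertexField ha hb hf _) _

theorem generator_eq_sum (a b f g : ℝ → ℝ) (x : ℝ) :
    a x * deriv g x + (1 / 2) * (b x) ^ 2 * iteratedDeriv 2 g x =
      ∑ κ : XColour, (κ.arity.factorial : ℝ)⁻¹ *
        (vertexField a b f (some κ) x ^ κ.arity * iteratedDeriv κ.arity g x) := by
  rw [XColour.sum_univ]
  simp [XColour.arity, vertexField, mul_assoc]

theorem generator_sum_elemDiff {a b f : ℝ → ℝ} (ha : ContDiff ℝ (⊤ : ℕ∞) a)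
    (hb : ContDiff ℝ (⊤ : ℕ∞) b) (hf : ContDiff ℝ (⊤ : ℕ∞) f) {fac : ExoticTree → ℚ}
    (hfac : IsTreeFactorial fac) {k : ℕ} {S S' : Finset ExoticTree}
    (hS : IsRepSystem (k + 1) S) (hS' : IsRepSystem (k + 2) S') {g : ℝ → ℝ}
    (hg : g = fun x => ∑ s ∈ S, facWeight fac s / s.sigmaE * elemDiff a b f s x) (x : ℝ) :
    a x * deriv g x + (1 / 2) * (b x) ^ 2 * iteratedDeriv 2 g x =
      ∑ t ∈ S', facWeight fac t / t.sigmaE * elemDiff a b f t x := by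
  have hD : ∀ j, iteratedDeriv j g x =
      ∑ s ∈ S, facWeight fac s / s.sigmaE * iteratedDeriv j (elemDiff a b f s) x := by
    intro j
    have hc : ∀ s, ContDiffAt ℝ j (elemDiff a b f s) x := fun s =>
      ((contDiff_elemDiff ha hb hf s).of_le (by exact_mod_cast le_top)).contDiffAt
    rw [hg, iteratedDeriv_fun_sum fun s _ => contDiffAt_const.mul (hc s)]
    exact Finset.sum_congr rfl fun s _ => iteratedDeriv_const_mul _ (hc s)
  rw [generator_eq_sum a b f]
  have hL : ∀ κ : XColour, vertexField a b f (some κ) x ^ κ.arity * iteratedDeriv κ.arity g x =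
      ∑ s ∈ S, ∑ t ∈ S', facWeight fac s / s.sigmaE *
        (elemDiff a b f t x / t.sigmaE * numGraft s κ t) := by
    intro κ
    rw [hD, Finset.mul_sum]
    refine Finset.sum_congr rfl fun s hs => ?_
    rw [← Finset.mul_sum, ← pow_mul_iteratedDeriv_elemDiff ha hb hf hS' (hS.effSize_eq s hs)]
    ring
  have hR : ∀ t ∈ S', facWeight fac t / t.sigmaE * elemDiff a b f t x =
      ∑ κ : XColour, ∑ s ∈ S, (κ.arity.factorial : ℝ)⁻¹ * (facWeight fac s / s.sigmaE *
        (elemDiff a b f t x / t.sigmaE * numGraft s κ t)) := by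
    intro t ht
    rw [facWeight_eq_sum_numGraft hfac hS (hS'.effSize_eq t ht), div_mul_eq_mul_div,
      mul_div_assoc, Finset.sum_mul, Finset.sum_comm]
    refine Finset.sum_congr rfl fun s _ => ?_
    rw [mul_assoc, Finset.sum_mul, Finset.mul_sum]
    exact Finset.sum_congr rfl fun κ _ => by ring
  rw [Finset.sum_congr rfl hR, Finset.sum_comm]
  refine Finset.sum_congr rfl fun κ _ => ?_
  rw [hL, Finset.mul_sum, Finset.sum_comm]
  simp only [Finset.mul_sum]

theorem sum_elemDiff_of_effSize_one (a b f : ℝ → ℝ) {fac : ExoticTree → ℚ}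
    (hfac : IsTreeFactorial fac) {S : Finset ExoticTree} (hS : IsRepSystem 1 S) (x : ℝ) :
    ∑ t ∈ S, facWeight fac t / t.sigmaE * elemDiff a b f t x = f x := by
  have hsub : Subsingleton (Fin (0 + 1)) := inferInstanceAs (Subsingleton (Fin 1))
  have hn : ∀ t : ExoticTree, t.effSize = 1 → t.n = 0 := by
    intro t ht
    have h1 := numBeta_eq t
    have h2 := card_vertices t
    simp only [effSize] at ht
    omega
  have hiso : ∀ t₁ t₂ : ExoticTree, t₁.n = 0 → t₂.n = 0 → t₁ = t₂ := by
    rintro ⟨n, p, c, m, _, _, hc, _, _, _⟩ ⟨n', p', c', m', _, _, hc', _, _, _⟩ rfl h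
    obtain rfl : n' = 0 := h
    obtain rfl : p = p' := Subsingleton.elim _ _
    obtain rfl : m = m' := Subsingleton.elim _ _
    obtain rfl : c = c' := by
      ext v : 1
      rw [Subsingleton.elim v 0, hc, hc']
    rfl
  let t₀ : ExoticTree :=
    { n := 0, parent := id, colour := fun _ => none, mate := id, parent_root := rfl
      reaches_root := fun _ => Subsingleton.elim _ _
      colour_root := rfl
      colour_nonroot := fun v hv => absurd (Subsingleton.elim v 0) hv
      mate_beta := by simp
      mate_nonbeta := by simp }
  have hsize : t₀.effSize = 1 := by simp [effSize, numAlpha, numPairs, t₀]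
  obtain ⟨t, ht, -⟩ := hS.exists_iso t₀ hsize
  obtain rfl := hiso t t₀ (hn t (hS.effSize_eq t ht)) rfl
  have hS1 : S = {t₀} := by
    refine Finset.eq_singleton_iff_unique_mem.2 ⟨ht, fun t' ht' => ?_⟩
    exact hiso t' t₀ (hn t' (hS.effSize_eq t' ht')) rfl
  have hσ : t₀.sigmaE = 1 := by
    have : Subsingleton (Equiv.Perm (Fin (t₀.n + 1))) :=
      inferInstanceAs (Subsingleton (Equiv.Perm (Fin 1)))
    exact le_antisymm (Finite.card_le_one_iff_subsingleton.2 inferInstance) (sigmaE_pos t₀)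
  rw [hS1, Finset.sum_singleton, hσ, facWeight, hsize, hfac.1 t₀ rfl]
  simp [elemDiff, nChildren, t₀]

end ExoticTree

/-- For smooth `α, β, f : ℝ → ℝ`, `u₀ ∈ ℝ` and the operator
`(Lg)(x) = α(x)g'(x) + ½β(x)²g''(x)`, for every `k ≥ 0`,
`(L^k f)(u₀) = Σ_{τ : |τ| = k+1} (|τ|!/(σ_e(τ)·τ!)) · Υ(τ)(u₀)`,
the sum running over all isomorphism classes of exotic coloured trees of effective
size `k+1` (encoded by a complete and irredundant finite set `S` of representatives);
`τ!` is (any function satisfying the defining recursion of) the exotic tree factorial. -/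
theorem stmt5 (a b f : ℝ → ℝ)
    (ha : ContDiff ℝ (⊤ : ℕ∞) a) (hb : ContDiff ℝ (⊤ : ℕ∞) b) (hf : ContDiff ℝ (⊤ : ℕ∞) f)
    (fac : ExoticTree → ℚ) (hfac : IsTreeFactorial fac)
    (u₀ : ℝ) (k : ℕ) (S : Finset ExoticTree)
    (hsize : ∀ τ ∈ S, τ.effSize = k + 1)
    (hirr : ∀ τ₁ ∈ S, ∀ τ₂ ∈ S, Iso τ₁ τ₂ → τ₁ = τ₂)
    (hcompl : ∀ τ : ExoticTree, τ.effSize = k + 1 → ∃ τ' ∈ S, Iso τ τ') :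
    (fun g x => a x * deriv g x + (1 / 2) * (b x) ^ 2 * iteratedDeriv 2 g x)^[k] f u₀
      = ∑ τ ∈ S, ((Nat.factorial τ.effSize : ℝ) / ((τ.sigmaE : ℝ) * ((fac τ : ℚ) : ℝ)))
          * elemDiff a b f τ u₀ := by
  have hS : IsRepSystem (k + 1) S := ⟨hsize, hirr, hcompl⟩
  have hcoef : ∀ τ : ExoticTree,
      (Nat.factorial τ.effSize : ℝ) / ((τ.sigmaE : ℝ) * ((fac τ : ℚ) : ℝ)) =
        facWeight fac τ / τ.sigmaE := fun τ => by
    rw [facWeight, div_div, mul_comm]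
  simp only [hcoef]
  clear hsize hirr hcompl
  induction k generalizing S u₀ with
  | zero => exact (sum_elemDiff_of_effSize_one a b f hfac hS u₀).symm
  | succ k ih =>
    obtain ⟨S₀, hS₀⟩ := exists_isRepSystem (k + 1)
    rw [Function.iterate_succ_apply']
    exact generator_sum_elemDiff ha hb hf hfac hS₀ hS (funext fun x => ih x S₀ hS₀) u₀
end

section
/- Fix T > 0. For every exotic coloured tree τ and every t ∈ [0, T], Π^e_t(τ) = (|τ|!/τ!) · t^{𝔩(τ)}/𝔩(τ)!, where |τ| is the effective size, 𝔩(τ) = |τ| − 1, and τ! is the exotic tree factorial. -/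
namespace ExoticTree

/-- The Heaviside step function with the Itô prescription `Θ(x) = 1` for `x > 0`
and `Θ(x) = 0` for `x ≤ 0`. -/
noncomputable def Heaviside (x : ℝ) : ℝ := if 0 < x then 1 else 0

/-- The integration variables of the realization map: one per α-vertex and one shared
per β-pair (the pair represented by its smaller member). -/
def itemSet (t : ExoticTree) : Finset (Fin (t.n + 1)) :=
  Finset.univ.filter fun v =>
    t.colour v = some XColour.alpha ∨
      (t.colour v = some XColour.beta ∧ v < t.mate v)

/-- The representative carrying the integration variable of a vertex: a β-vertex
shares the variable of its mate (both members of a pair carry the same variable). -/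
def timeRep (t : ExoticTree) (v : Fin (t.n + 1)) : Fin (t.n + 1) :=
  if t.colour v = some XColour.beta ∧ t.mate v < v then t.mate v else v

/-- The time assigned to a vertex: the root's variable is fixed to `time`, every other
vertex carries the integration variable of its representative. -/
noncomputable def vertexTime (t : ExoticTree) (time : ℝ)
    (x : {v : Fin (t.n + 1) // v ∈ t.itemSet} → ℝ) (v : Fin (t.n + 1)) : ℝ :=
  if h : t.timeRep v ∈ t.itemSet then x ⟨t.timeRep v, h⟩ else time

/-- The exotic realization map `Π^e_time(t)`: the integral over `[0,T]^{𝔩(t)}` (one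
variable per α-vertex, one shared variable per β-pair, the root's variable fixed to
`time`) of the product over all edges `e = (parent, child)` of
`Θ(t_parent − t_child)`. -/
noncomputable def realize (t : ExoticTree) (T time : ℝ) : ℝ :=
  ∫ x in Set.univ.pi fun _ : {v : Fin (t.n + 1) // v ∈ t.itemSet} => Set.Icc (0 : ℝ) T,
    ∏ v ∈ Finset.univ.filter fun v : Fin (t.n + 1) => v ≠ 0,
      Heaviside (t.vertexTime time x (t.parent v) - t.vertexTime time x v)


end ExoticTree

open ExoticTree

open MeasureTheory in
/-- Distinct coordinates almost everywhere. -/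
theorem volume_setOf_apply_eq_apply {ι : Type*} [Fintype ι] {i j : ι} (hij : i ≠ j) :
    volume {x : ι → ℝ | x i = x j} = 0 := by
  classical
  let p : Submodule ℝ (ι → ℝ) :=
    LinearMap.ker (LinearMap.proj (R := ℝ) (φ := fun _ : ι => ℝ) i - LinearMap.proj j)
  have hp : (p : Set (ι → ℝ)) = {x | x i = x j} := by
    ext x
    simp [p, sub_eq_zero]
  rw [← hp]
  refine Measure.addHaar_submodule volume p fun htop => ?_
  have : Pi.single i (1 : ℝ) ∈ p := htop ▸ Submodule.mem_top
  simp [p, hij.symm] at this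

open MeasureTheory in
/-- Splitting off one coordinate preserves Lebesgue measure. -/
theorem measurePreserving_splitCoord {ι : Type*} [Fintype ι] [DecidableEq ι] (i : ι) :
    MeasurePreserving fun x : ι → ℝ => (x i, fun j : {j // j ≠ i} => x j) := by
  have hsplit := volume_preserving_piEquivPiSubtypeProd (fun _ : ι => ℝ) (· = i)
  have hunique : Unique.fintype = Subtype.fintype (· = i) := Subsingleton.elim _ _
  have hprod := (volume_preserving_funUnique {j // j = i} ℝ).prod
    (MeasurePreserving.id (volume : Measure ({j // ¬ j = i} → ℝ)))
  rw [← Measure.volume_eq_prod, ← Measure.volume_eq_prod, hunique] at hprod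
  exact hprod.comp hsplit

/-- The points of the open cube `(a, b)^ι` whose coordinates are increasing along `R`. -/
def orderRegion {ι : Type*} (R : ι → ι → Prop) (a b : ℝ) : Set (ι → ℝ) :=
  {x | (∀ i, x i ∈ Set.Ioo a b) ∧ ∀ i j, R i j → x i < x j}

theorem measurableSet_orderRegion {ι : Type*} [Countable ι] (R : ι → ι → Prop) (a b : ℝ) :
    MeasurableSet (orderRegion R a b) := by
  simp only [orderRegion, Set.ofPred_and, Set.ofPred_forall]
  refine (MeasurableSet.iInter fun i => measurable_pi_apply i measurableSet_Ioo).inter <|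
    .iInter fun i => .iInter fun j => .iInter fun _ =>
      measurableSet_lt (measurable_pi_apply i) (measurable_pi_apply j)

open MeasureTheory in
theorem volume_orderRegion_congr {ι κ : Type*} [Fintype ι] [Fintype κ] {R : ι → ι → Prop}
    {S : κ → κ → Prop} (e : ι ≃ κ) (h : ∀ i j, R i j ↔ S (e i) (e j)) (a b : ℝ) :
    volume (orderRegion R a b) = volume (orderRegion S a b) := by
  have hpre : (fun x : κ → ℝ => x ∘ e) ⁻¹' orderRegion R a b = orderRegion S a b := by
    ext x
    simp only [orderRegion, Set.mem_preimage, Set.mem_ofPred_eq, Function.comp_apply, h]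
    rw [e.forall_congr_left, e.forall_congr_left]
    simp only [e.forall_congr_left, Equiv.apply_symm_apply]
  have hmp : MeasurePreserving fun x : κ → ℝ => x ∘ e :=
    (volume_measurePreserving_piCongrLeft (fun _ : κ => ℝ) e).symm
  rw [← hpre, hmp.measure_preimage (measurableSet_orderRegion R a b).nullMeasurableSet]

/-- The part of `orderRegion R a b` where the coordinate `i` is strictly the smallest. -/
def orderRegionMin {ι : Type*} (R : ι → ι → Prop) (a b : ℝ) (i : ι) : Set (ι → ℝ) :=
  {x | x ∈ orderRegion R a b ∧ ∀ j ≠ i, x i < x j}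

theorem measurableSet_orderRegionMin {ι : Type*} [Countable ι] (R : ι → ι → Prop) (a b : ℝ)
    (i : ι) : MeasurableSet (orderRegionMin R a b i) := by
  simp only [orderRegionMin, Set.ofPred_and, Set.ofPred_forall]
  exact (measurableSet_orderRegion R a b).inter <| .iInter fun j => .iInter fun _ =>
    measurableSet_lt (measurable_pi_apply i) (measurable_pi_apply j)

theorem orderRegionMin_eq_empty {ι : Type*} {R : ι → ι → Prop} {i j : ι} (h : R j i)
    (a b : ℝ) : orderRegionMin R a b i = ∅ := by
  refine Set.eq_empty_of_forall_notMem fun x hx => ?_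
  have hji := hx.1.2 j i h
  exact hji.not_gt (hx.2 j fun he => (he ▸ hji).false)

open MeasureTheory in
theorem volume_orderRegionMin {ι : Type*} [Fintype ι] [DecidableEq ι] {R : ι → ι → Prop} {i : ι}
    (h : ∀ j, ¬ R j i) (a b : ℝ) :
    volume (orderRegionMin R a b i) =
      ∫⁻ s in Set.Ioo a b, volume (orderRegion (fun j k : {j // j ≠ i} => R j k) s b) := by
  let G : Set (ℝ × ({j // j ≠ i} → ℝ)) :=
    {p | p.1 ∈ Set.Ioo a b ∧ (∀ j, p.1 < p.2 j ∧ p.2 j < b) ∧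
      ∀ j k : {j // j ≠ i}, R j k → p.2 j < p.2 k}
  have hG : MeasurableSet G := by
    simp only [G, Set.ofPred_and, Set.ofPred_forall]
    refine (measurable_fst measurableSet_Ioo).inter <| (MeasurableSet.iInter fun j => ?_).inter <|
      .iInter fun j => .iInter fun k => .iInter fun _ => ?_
    · exact (measurableSet_lt measurable_fst (by fun_prop)).inter
        (measurableSet_lt (by fun_prop) measurable_const)
    · exact measurableSet_lt (by fun_prop) (by fun_prop)
  have hpre : (fun x : ι → ℝ => (x i, fun j : {j // j ≠ i} => x j)) ⁻¹' G =
      orderRegionMin R a b i := by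
    ext x
    simp only [G, orderRegionMin, orderRegion, Set.mem_preimage, Set.mem_ofPred_eq, Set.mem_Ioo]
    constructor
    · rintro ⟨hi, hb, hR⟩
      have hmin : ∀ j, j ≠ i → x i < x j := fun j hj => (hb ⟨j, hj⟩).1
      refine ⟨⟨fun j => ?_, fun j k hjk => ?_⟩, hmin⟩
      · by_cases hj : j = i
        · exact hj ▸ hi
        · exact ⟨hi.1.trans (hmin j hj), (hb ⟨j, hj⟩).2⟩
      · have hk : k ≠ i := fun hk => h j (hk ▸ hjk)
        by_cases hj : j = i
        · exact hj ▸ hmin k hk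
        · exact hR ⟨j, hj⟩ ⟨k, hk⟩ hjk
    · rintro ⟨⟨hb, hR⟩, hmin⟩
      exact ⟨hb i, fun j => ⟨hmin j j.2, (hb j).2⟩, fun j k => hR j k⟩
  rw [← hpre, (measurePreserving_splitCoord i).measure_preimage hG.nullMeasurableSet,
    Measure.volume_eq_prod, Measure.prod_apply hG, ← lintegral_indicator measurableSet_Ioo]
  refine lintegral_congr fun s => ?_
  by_cases hs : s ∈ Set.Ioo a b
  · rw [Set.indicator_of_mem hs]
    congr 1
    ext z
    exact and_iff_right hs
  · rw [Set.indicator_of_notMem hs]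
    have : Prod.mk s ⁻¹' G = ∅ := Set.eq_empty_of_forall_notMem fun z hz => hs hz.1
    rw [this, measure_empty]

open MeasureTheory in
/-- Decomposition of the volume of an order region according to its smallest coordinate. -/
theorem volume_orderRegion_eq_sum {ι : Type*} [Fintype ι] [DecidableEq ι] [Nonempty ι]
    (R : ι → ι → Prop) [DecidablePred fun i => ∀ j, ¬ R j i] (a b : ℝ) :
    volume (orderRegion R a b) = ∑ i : ι, if ∀ j, ¬ R j i then
      ∫⁻ s in Set.Ioo a b, volume (orderRegion (fun j k : {j // j ≠ i} => R j k) s b) else 0 := by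
  have hae : orderRegion R a b =ᵐ[volume] ⋃ i, orderRegionMin R a b i := by
    have hne : ∀ᵐ x : ι → ℝ, ∀ i j, i ≠ j → x i ≠ x j := by
      refine ae_all_iff.2 fun i => ae_all_iff.2 fun j => ?_
      by_cases hij : i = j
      · simp [hij]
      · filter_upwards [measure_eq_zero_iff_ae_notMem.1 (volume_setOf_apply_eq_apply hij)]
          with x hx _ using hx
    filter_upwards [hne] with x hx
    refine propext ⟨fun hmem => ?_, fun hmem => ?_⟩
    · obtain ⟨i, hi⟩ := Finite.exists_min x
      exact Set.mem_iUnion.2 ⟨i, hmem, fun j hj => (hi j).lt_of_ne (hx i j hj.symm)⟩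
    · obtain ⟨i, hi⟩ := Set.mem_iUnion.1 hmem
      exact hi.1
  have hdisj : Pairwise (Function.onFun Disjoint (orderRegionMin R a b)) := fun i j hij =>
    Set.disjoint_left.2 fun x hi hj => (hi.2 j hij.symm).not_gt (hj.2 i hij)
  rw [measure_congr hae, measure_iUnion hdisj (measurableSet_orderRegionMin R a b), tsum_fintype]
  refine Finset.sum_congr rfl fun i _ => ?_
  split_ifs with h
  · exact volume_orderRegionMin h a b
  · push Not at h
    obtain ⟨j, hj⟩ := h
    rw [orderRegionMin_eq_empty hj, measure_empty]

open MeasureTheory in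
theorem lintegral_Ioo_sub_pow {a b c : ℝ} (hab : a ≤ b) (hc : 0 ≤ c) (k : ℕ) :
    ∫⁻ s in Set.Ioo a b, ENNReal.ofReal (c * (b - s) ^ k / k.factorial) =
      ENNReal.ofReal (c * (b - a) ^ (k + 1) / (k + 1).factorial) := by
  have hcont : Continuous fun s : ℝ => c * (b - s) ^ k / k.factorial := by fun_prop
  rw [← ofReal_integral_eq_lintegral_ofReal]
  · congr 1
    rw [← integral_Ioc_eq_integral_Ioo, ← intervalIntegral.integral_of_le hab]
    rw [intervalIntegral.integral_div, intervalIntegral.integral_const_mul,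
      intervalIntegral.integral_comp_sub_left (fun s => s ^ k), integral_pow, Nat.factorial_succ]
    have : (k.factorial : ℝ) ≠ 0 := by positivity
    have : (k : ℝ) + 1 ≠ 0 := by positivity
    push_cast
    field_simp
    simp
  · exact (hcont.integrableOn_Icc (a := a) (b := b)).mono_set Set.Ioo_subset_Icc_self
  · refine (ae_restrict_iff' measurableSet_Ioo).2 (.of_forall fun s hs => ?_)
    have : 0 ≤ b - s := sub_nonneg.2 hs.2.le
    positivity

/-- If every point of `Fin (n + 1)` eventually reaches the fixed point `0` of `f`, then it does so
within `n` steps. -/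
theorem Fin.iterate_eq_zero_of_exists {n : ℕ} {f : Fin (n + 1) → Fin (n + 1)} (hf : f 0 = 0)
    {v : Fin (n + 1)} (hv : ∃ k, f^[k] v = 0) : f^[n] v = 0 := by
  classical
  obtain ⟨hk, hmin⟩ := And.intro (Nat.find_spec hv) fun m => Nat.find_min (H := hv) (m := m)
  set k := Nat.find hv
  by_cases hkn : k ≤ n
  · have := Function.iterate_add_apply f (n - k) k v
    rwa [Nat.sub_add_cancel hkn, hk, Function.iterate_fixed hf] at this
  · have hlt : ∀ i j : Fin (k + 1), i < j → f^[i] v ≠ f^[j] v := fun i j hij h => by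
      have hi : (i : ℕ) < j := hij
      have hj : (j : ℕ) ≤ k := Nat.lt_succ_iff.1 j.2
      refine hmin (m := k - j + i) (by omega) ?_
      rw [Function.iterate_add_apply, h, ← Function.iterate_add_apply, Nat.sub_add_cancel hj, hk]
    have hinj : Function.Injective fun i : Fin (k + 1) => f^[i] v := fun i j h => by
      rcases lt_trichotomy i j with hij | hij | hij
      · exact absurd h (hlt i j hij)
      · exact hij
      · exact absurd h.symm (hlt j i hij)
    have := Fintype.card_le_of_injective _ hinj
    simp only [Fintype.card_fin] at this
    omega

namespace ExoticTree

/-- A monotone embedding of exotic trees compatible with all the structure. -/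
structure IsSubtree (t' t : ExoticTree) (e : Fin (t'.n + 1) ↪o Fin (t.n + 1)) : Prop where
  map_zero : e 0 = 0
  colour_map : ∀ w, t.colour (e w) = t'.colour w
  parent_map : ∀ w, t.parent (e w) = e (t'.parent w)
  mate_map : ∀ w, t.mate (e w) = e (t'.mate w)

/-- A set of vertices containing the root and closed under `parent` and `mate` spans a subtree. -/
theorem exists_isSubtree (t : ExoticTree) (S : Finset (Fin (t.n + 1))) (h0 : 0 ∈ S)
    (hp : ∀ v ∈ S, t.parent v ∈ S) (hm : ∀ v ∈ S, t.mate v ∈ S) :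
    ∃ (t' : ExoticTree) (e : Fin (t'.n + 1) ↪o Fin (t.n + 1)),
      IsSubtree t' t e ∧ Set.range e = S := by
  obtain ⟨m, hcard⟩ := Nat.exists_eq_succ_of_ne_zero (Finset.card_ne_zero_of_mem h0)
  let e := S.orderEmbOfFin hcard
  have hrange : Set.range e = S := S.range_orderEmbOfFin hcard
  have hmem : ∀ w, e w ∈ S := S.orderEmbOfFin_mem hcard
  have hsurj : ∀ v ∈ S, ∃ w, e w = v := fun v hv => by
    have : v ∈ Set.range e := hrange ▸ hv
    exact this
  choose p hp' using fun w => hsurj _ (hp _ (hmem w))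
  choose q hq' using fun w => hsurj _ (hm _ (hmem w))
  have hzero : e 0 = 0 := by
    obtain ⟨w, hw⟩ := hsurj 0 h0
    exact Fin.le_zero_iff.1 (hw ▸ e.monotone (Fin.zero_le w))
  have hp0 : p 0 = 0 := e.injective (by rw [hp', hzero, t.parent_root])
  have hiter : ∀ k w, e (p^[k] w) = t.parent^[k] (e w) := fun k => by
    induction k with
    | zero => exact fun _ => rfl
    | succ k ih => exact fun w => by rw [Function.iterate_succ_apply, ih, hp',
        Function.iterate_succ_apply]
  refine ⟨⟨m, p, fun w => t.colour (e w), q, hp0, fun w => ?_, ?_, ?_, ?_, ?_⟩, e,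
    ⟨hzero, fun _ => rfl, fun w => (hp' w).symm, fun w => (hq' w).symm⟩, hrange⟩
  · exact Fin.iterate_eq_zero_of_exists hp0
      ⟨t.n, e.injective (by rw [hiter, t.reaches_root, hzero])⟩
  · exact hzero ▸ t.colour_root
  · exact fun w hw => t.colour_nonroot _ fun h => hw (e.injective (h.trans hzero.symm))
  · intro w hw
    obtain ⟨h1, h2, h3⟩ := t.mate_beta _ hw
    refine ⟨by rwa [hq'], e.injective (by rw [hq', hq', h2]), fun h => h3 ?_⟩
    rw [← hq', h]
  · exact fun w hw => e.injective (by rw [hq', t.mate_nonbeta _ hw])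

theorem mem_itemSet {t : ExoticTree} {v : Fin (t.n + 1)} : v ∈ t.itemSet ↔
    t.colour v = some XColour.alpha ∨ (t.colour v = some XColour.beta ∧ v < t.mate v) := by
  simp [itemSet]

theorem timeRep_of_mem_itemSet {t : ExoticTree} {v : Fin (t.n + 1)} (hv : v ∈ t.itemSet) :
    t.timeRep v = v := by
  refine if_neg fun h => ?_
  rcases mem_itemSet.1 hv with hv | hv
  · simp [hv] at h
  · exact h.2.not_gt hv.2

theorem timeRep_mem_itemSet {t : ExoticTree} {v : Fin (t.n + 1)} (hv : v ≠ 0) :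
    t.timeRep v ∈ t.itemSet := by
  rw [mem_itemSet, timeRep]
  rcases h : t.colour v with _ | _ | _
  · exact absurd h (t.colour_nonroot v hv)
  · simp [h]
  · obtain ⟨h1, h2, h3⟩ := t.mate_beta v h
    rcases lt_or_gt_of_ne h3 with hlt | hlt
    · simp [hlt, h1, h2]
    · simp [hlt.not_gt, hlt, h]

theorem zero_notMem_itemSet (t : ExoticTree) : (0 : Fin (t.n + 1)) ∉ t.itemSet := by
  simp [mem_itemSet, t.colour_root]

theorem timeRep_zero (t : ExoticTree) : t.timeRep 0 = 0 := by
  simp [timeRep, t.colour_root]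

theorem timeRep_mem_itemSet_iff {t : ExoticTree} {v : Fin (t.n + 1)} :
    t.timeRep v ∈ t.itemSet ↔ v ≠ 0 :=
  ⟨fun h h0 => t.zero_notMem_itemSet (by rwa [h0, timeRep_zero] at h), timeRep_mem_itemSet⟩

theorem timeRep_mate (t : ExoticTree) (v : Fin (t.n + 1)) :
    t.timeRep (t.mate v) = t.timeRep v := by
  by_cases h : t.colour v = some XColour.beta
  · obtain ⟨h1, h2, h3⟩ := t.mate_beta v h
    rcases lt_or_gt_of_ne h3 with hlt | hlt
    · simp [timeRep, h, h1, h2, hlt, hlt.not_gt]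
    · simp [timeRep, h, h1, h2, hlt, hlt.not_gt]
  · rw [t.mate_nonbeta v h]

theorem timeRep_eq_alpha {t : ExoticTree} {v u : Fin (t.n + 1)}
    (hv : t.colour v = some XColour.alpha) : t.timeRep u = v ↔ u = v := by
  refine ⟨fun h => ?_, fun h => h ▸ timeRep_of_mem_itemSet (mem_itemSet.2 (.inl (h ▸ hv)))⟩
  unfold timeRep at h
  split_ifs at h with hu
  · have := (t.mate_beta u hu.1).1
    simp [h, hv] at this
  · exact h

theorem timeRep_eq_beta {t : ExoticTree} {v u : Fin (t.n + 1)}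
    (hv : t.colour v = some XColour.beta) (hlt : v < t.mate v) :
    t.timeRep u = v ↔ u = v ∨ u = t.mate v := by
  have hrep : t.timeRep v = v := timeRep_of_mem_itemSet (mem_itemSet.2 (.inr ⟨hv, hlt⟩))
  constructor
  · intro h
    unfold timeRep at h
    split_ifs at h with hu
    · exact .inr (by rw [← h, (t.mate_beta u hu.1).2.1])
    · exact .inl h
  · rintro (rfl | rfl)
    · exact hrep
    · rw [timeRep_mate, hrep]

theorem parent_ne_self {t : ExoticTree} {v : Fin (t.n + 1)} (hv : v ≠ 0) : t.parent v ≠ v :=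
  fun h => hv (by rw [← t.reaches_root v, Function.iterate_fixed h])

/-- The items none of whose vertices has a child. -/
def removable (t : ExoticTree) : Finset (Fin (t.n + 1)) :=
  t.itemSet.filter fun i => ∀ u, t.timeRep (t.parent u) ≠ i

theorem removable_subset (t : ExoticTree) : t.removable ⊆ t.itemSet :=
  Finset.filter_subset _ _

theorem mem_alphaLeaves {t : ExoticTree} {v : Fin (t.n + 1)} :
    v ∈ t.alphaLeaves ↔ v ∈ t.removable ∧ t.colour v = some XColour.alpha := by
  simp only [alphaLeaves, removable, Finset.mem_filter, Finset.mem_univ, true_and, mem_itemSet]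
  by_cases hc : t.colour v = some XColour.alpha
  · have hv : v ≠ 0 := fun h => by simp [h, t.colour_root] at hc
    simp only [hc, timeRep_eq_alpha hc, ne_eq, true_and, true_or, and_true]
    exact ⟨fun h u hu => parent_ne_self hv (by rwa [h u hu] at hu), fun h u hu => absurd hu (h u)⟩
  · simp [hc]

theorem mem_betaLeafPairs {t : ExoticTree} {v : Fin (t.n + 1)} :
    v ∈ t.betaLeafPairs ↔ v ∈ t.removable ∧ t.colour v ≠ some XColour.alpha := by
  simp only [betaLeafPairs, removable, Finset.mem_filter, Finset.mem_univ, true_and, mem_itemSet]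
  by_cases hc : t.colour v = some XColour.beta ∧ v < t.mate v
  · obtain ⟨hc, hlt⟩ := hc
    have hv : v ≠ 0 := fun h => by simp [h, t.colour_root] at hc
    have hm : t.mate v ≠ 0 := (Fin.zero_le v).trans_lt hlt |>.ne'
    simp only [hc, hlt, timeRep_eq_beta hc hlt, ne_eq, true_and, and_true, not_or, or_true,
      reduceCtorEq, not_false_eq_true, Option.some.injEq]
    exact ⟨fun h u => ⟨fun hu => parent_ne_self hv (by rwa [h.1 u hu] at hu),
        fun hu => parent_ne_self hm (by rwa [h.2 u hu] at hu)⟩,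
      fun h => ⟨fun u hu => absurd hu (h u).1, fun u hu => absurd hu (h u).2⟩⟩
  · grind

theorem sum_removable (t : ExoticTree) (f : Fin (t.n + 1) → ℚ) :
    ∑ i ∈ t.removable, f i = ∑ i ∈ t.alphaLeaves, f i + ∑ i ∈ t.betaLeafPairs, f i := by
  rw [← Finset.sum_filter_add_sum_filter_not t.removable
    (fun i => t.colour i = some XColour.alpha)]
  congr 2
  · ext v
    rw [mem_alphaLeaves, Finset.mem_filter]
  · ext v
    rw [mem_betaLeafPairs, Finset.mem_filter]

theorem effSize_eq (t : ExoticTree) : t.effSize = t.itemSet.card + 1 := by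
  have hdisj : Disjoint
      (Finset.univ.filter fun v : Fin (t.n + 1) => t.colour v = some XColour.alpha)
      (Finset.univ.filter fun v => t.colour v = some XColour.beta ∧ v < t.mate v) :=
    Finset.disjoint_filter.2 fun v _ h h' => by simp [h] at h'
  rw [effSize, numAlpha, numPairs, itemSet, Finset.filter_or, Finset.card_union_of_disjoint hdisj]
  ring

theorem edgeCount_eq (t : ExoticTree) : t.edgeCount = t.itemSet.card := by
  rw [edgeCount, effSize_eq, Nat.add_sub_cancel]

/-- `t'` is the subtree of `t` spanned by the vertices not carrying the item `i`. -/
def IsItemRemoval (t : ExoticTree) (i : Fin (t.n + 1)) (t' : ExoticTree) : Prop :=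
  ∃ e : Fin (t'.n + 1) ↪o Fin (t.n + 1), IsSubtree t' t e ∧ Set.range e = {u | t.timeRep u ≠ i}

theorem exists_isItemRemoval {t : ExoticTree} {i : Fin (t.n + 1)} (hi : i ∈ t.removable) :
    ∃ t', t.IsItemRemoval i t' := by
  obtain ⟨hi, hmin⟩ := Finset.mem_filter.1 hi
  obtain ⟨t', e, he, hrange⟩ := t.exists_isSubtree (Finset.univ.filter fun u => t.timeRep u ≠ i)
    (by
      rw [Finset.mem_filter, timeRep_zero]
      exact ⟨Finset.mem_univ _, fun h => t.zero_notMem_itemSet (h ▸ hi)⟩)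
    (fun v _ => by simpa using hmin v)
    (fun v hv => by simpa [timeRep_mate] using hv)
  exact ⟨t', e, he, by simpa using hrange⟩

theorem IsItemRemoval.isAlphaLeafRemoval {t t' : ExoticTree} {i : Fin (t.n + 1)}
    (h : t.IsItemRemoval i t') (hi : i ∈ t.alphaLeaves) : t.IsAlphaLeafRemoval i t' := by
  obtain ⟨e, he, hrange⟩ := h
  obtain ⟨hc, hl⟩ := (Finset.mem_filter.1 hi).2
  exact ⟨hc, hl, e.toEmbedding, he.map_zero, by simpa [timeRep_eq_alpha hc] using hrange,
    he.colour_map, he.parent_map, he.mate_map⟩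

theorem IsItemRemoval.isBetaPairLeafRemoval {t t' : ExoticTree} {i : Fin (t.n + 1)}
    (h : t.IsItemRemoval i t') (hi : i ∈ t.betaLeafPairs) : t.IsBetaPairLeafRemoval i t' := by
  obtain ⟨e, he, hrange⟩ := h
  obtain ⟨hc, hlt, hl, hl'⟩ := (Finset.mem_filter.1 hi).2
  exact ⟨hc, hl, hl', e.toEmbedding, he.map_zero, by simpa [timeRep_eq_beta hc hlt] using hrange,
    he.colour_map, he.parent_map, he.mate_map⟩

/-- The order constraints between the integration variables. -/
def itemRel (t : ExoticTree) (i j : {v : Fin (t.n + 1) // v ∈ t.itemSet}) : Prop :=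
  ∃ u, t.timeRep u = i ∧ t.timeRep (t.parent u) = j

theorem forall_not_itemRel_iff {t : ExoticTree} {i : {v : Fin (t.n + 1) // v ∈ t.itemSet}} :
    (∀ j, ¬ t.itemRel j i) ↔ (i : Fin (t.n + 1)) ∈ t.removable := by
  rw [removable, Finset.mem_filter, and_iff_right i.2]
  refine ⟨fun h u hu => ?_, fun h j ⟨u, _, hu⟩ => h u hu⟩
  have hpu : t.parent u ≠ 0 := timeRep_mem_itemSet_iff.1 (hu ▸ i.2)
  have hu0 : u ≠ 0 := fun h => hpu (h ▸ t.parent_root)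
  exact h ⟨t.timeRep u, timeRep_mem_itemSet hu0⟩ ⟨u, rfl, hu⟩

theorem IsSubtree.timeRep_map {t' t : ExoticTree} {e : Fin (t'.n + 1) ↪o Fin (t.n + 1)}
    (he : IsSubtree t' t e) (w : Fin (t'.n + 1)) : t.timeRep (e w) = e (t'.timeRep w) := by
  simp only [timeRep, he.colour_map, he.mate_map, e.lt_iff_lt, apply_ite e]

theorem IsSubtree.map_mem_itemSet {t' t : ExoticTree} {e : Fin (t'.n + 1) ↪o Fin (t.n + 1)}
    (he : IsSubtree t' t e) {w : Fin (t'.n + 1)} : e w ∈ t.itemSet ↔ w ∈ t'.itemSet := by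
  simp only [mem_itemSet, he.colour_map, he.mate_map, e.lt_iff_lt]

/-- Removing an item yields a tree whose items are the remaining ones, with the same order
constraints. -/
theorem IsItemRemoval.exists_equiv {t t' : ExoticTree} {i : {v : Fin (t.n + 1) // v ∈ t.itemSet}}
    (h : t.IsItemRemoval i t') :
    ∃ f : {v : Fin (t'.n + 1) // v ∈ t'.itemSet} ≃ {j // j ≠ i},
      ∀ j k, t'.itemRel j k ↔ t.itemRel (f j) (f k) := by
  obtain ⟨e, he, hrange⟩ := h
  have hne : ∀ w, t.timeRep (e w) ≠ i := fun w => by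
    have : e w ∈ {u | t.timeRep u ≠ i} := hrange ▸ Set.mem_range_self w
    exact this
  have hsurj : ∀ u, t.timeRep u ≠ i → ∃ w, e w = u := fun u hu => by
    have : u ∈ Set.range e := hrange ▸ hu
    exact this
  let f : {v : Fin (t'.n + 1) // v ∈ t'.itemSet} → {j // j ≠ i} := fun w =>
    ⟨⟨e w, he.map_mem_itemSet.2 w.2⟩, fun h => hne w (by
      rw [timeRep_of_mem_itemSet (he.map_mem_itemSet.2 w.2), ← h])⟩
  have hf : Function.Bijective f := by
    refine ⟨fun v w h => Subtype.ext (e.injective ?_), fun ⟨⟨v, hv⟩, hvi⟩ => ?_⟩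
    · exact congrArg (fun j => (j.1.1 : Fin (t.n + 1))) h
    · obtain ⟨w, rfl⟩ := hsurj v fun h => hvi (Subtype.ext (by
        rw [← h, timeRep_of_mem_itemSet hv]))
      exact ⟨⟨w, he.map_mem_itemSet.1 hv⟩, rfl⟩
  refine ⟨Equiv.ofBijective f hf, fun j k => ⟨fun ⟨u, hj, hk⟩ => ⟨e u, ?_, ?_⟩, ?_⟩⟩
  · rw [he.timeRep_map, hj]
    rfl
  · rw [he.parent_map, he.timeRep_map, hk]
    rfl
  · rintro ⟨u, hj, hk⟩
    have hje : t.timeRep u = e j := hj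
    have hke : t.timeRep (t.parent u) = e k := hk
    obtain ⟨w, rfl⟩ := hsurj u fun h => (f j).2 (Subtype.ext (hj.symm.trans h))
    rw [he.timeRep_map] at hje
    rw [he.parent_map, he.timeRep_map] at hke
    exact ⟨w, e.injective hje, e.injective hke⟩

theorem IsItemRemoval.card_itemSet {t t' : ExoticTree} {i : Fin (t.n + 1)} (hi : i ∈ t.itemSet)
    (h : t.IsItemRemoval i t') : t.itemSet.card = t'.itemSet.card + 1 := by
  obtain ⟨f, -⟩ := IsItemRemoval.exists_equiv (i := ⟨i, hi⟩) h
  have := Fintype.card_congr f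
  rw [Fintype.card_coe, Fintype.card_subtype_compl, Fintype.card_subtype_eq, Fintype.card_coe] at this
  have := Finset.card_pos.2 ⟨i, hi⟩
  omega

/-- The number `|τ|! / τ!`. -/
noncomputable def growthCount (fac : ExoticTree → ℚ) (t : ExoticTree) : ℚ :=
  t.effSize.factorial / fac t

theorem itemSet_eq_empty_iff {t : ExoticTree} : t.itemSet = ∅ ↔ t.n = 0 := by
  constructor
  · intro h
    by_contra hn
    have : Fin.last t.n ≠ 0 := fun h0 => hn (by simpa using congrArg Fin.val h0)
    exact Finset.notMem_empty _ (h ▸ timeRep_mem_itemSet this)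
  · intro h
    refine Finset.eq_empty_of_forall_notMem fun v hv => t.zero_notMem_itemSet ?_
    rwa [show (0 : Fin (t.n + 1)) = v from Fin.ext (by simp; omega)]

theorem growthCount_of_n_eq_zero {fac : ExoticTree → ℚ} (hfac : IsTreeFactorial fac)
    {t : ExoticTree} (ht : t.n = 0) : growthCount fac t = 1 := by
  rw [growthCount, hfac.1 t ht, effSize_eq, itemSet_eq_empty_iff.2 ht]
  simp

theorem growthCount_eq_sum {fac : ExoticTree → ℚ} (hfac : IsTreeFactorial fac)
    {t : ExoticTree} (ht : t.n ≠ 0) {r : Fin (t.n + 1) → ExoticTree}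
    (hr : ∀ i ∈ t.removable, t.IsItemRemoval i (r i)) :
    growthCount fac t = ∑ i ∈ t.removable, growthCount fac (r i) := by
  have hrec := hfac.2 t (Nat.pos_of_ne_zero ht) (fun i _ => r i) (fun i _ => r i)
    (fun i h => (hr i (mem_alphaLeaves.1 h).1).isAlphaLeafRemoval h)
    (fun i h => (hr i (mem_betaLeafPairs.1 h).1).isBetaPairLeafRemoval h)
  rw [Finset.sum_attach t.alphaLeaves (fun i => 1 / fac (r i)),
    Finset.sum_attach t.betaLeafPairs (fun i => 1 / fac (r i)), ← sum_removable] at hrec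
  have hsucc : t.effSize.factorial = t.effSize * t.itemSet.card.factorial := by
    rw [effSize_eq, Nat.factorial_succ]
  rw [growthCount, hsucc, Nat.cast_mul, mul_div_right_comm, hrec, Finset.sum_mul]
  refine Finset.sum_congr rfl fun i hi => ?_
  rw [growthCount, effSize_eq, (hr i hi).card_itemSet (t.removable_subset hi)]
  ring

open MeasureTheory in
/-- The volume of the region cut out by the order constraints of a tree. -/
theorem volume_orderRegion_itemRel {fac : ExoticTree → ℚ} (hfac : IsTreeFactorial fac)
    (t : ExoticTree) : 0 ≤ growthCount fac t ∧ ∀ a b : ℝ, a ≤ b →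
      volume (orderRegion t.itemRel a b) =
        ENNReal.ofReal (growthCount fac t * (b - a) ^ t.edgeCount / t.edgeCount.factorial) := by
  classical
  induction h : t.itemSet.card generalizing t with
  | zero =>
    have hempty := Finset.card_eq_zero.1 h
    have : IsEmpty {v : Fin (t.n + 1) // v ∈ t.itemSet} := ⟨fun v => by simpa [hempty] using v.2⟩
    rw [growthCount_of_n_eq_zero hfac (itemSet_eq_empty_iff.1 hempty), edgeCount_eq, h]
    refine ⟨zero_le_one, fun a b _ => ?_⟩
    have huniv : orderRegion t.itemRel a b = Set.univ :=
      Set.eq_univ_of_forall fun x => ⟨isEmptyElim, isEmptyElim⟩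
    simp [huniv, volume_pi]
  | succ k ih =>
    have hn : t.n ≠ 0 := fun hn => by simp [itemSet_eq_empty_iff.2 hn] at h
    obtain ⟨i₀, hi₀⟩ : t.itemSet.Nonempty := Finset.card_pos.1 (by omega)
    have : Nonempty {v : Fin (t.n + 1) // v ∈ t.itemSet} := ⟨⟨i₀, hi₀⟩⟩
    have hex : ∀ i, ∃ t', i ∈ t.removable → t.IsItemRemoval i t' := fun i => by
      by_cases hi : i ∈ t.removable
      · exact (exists_isItemRemoval hi).imp fun _ h _ => h
      · exact ⟨t, fun h => absurd h hi⟩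
    choose r hr using hex
    have hcard : ∀ i ∈ t.removable, (r i).itemSet.card = k := fun i hi => by
      have := (hr i hi).card_itemSet (t.removable_subset hi)
      omega
    have hsum := growthCount_eq_sum hfac hn hr
    have hnonneg : ∀ i ∈ t.removable, 0 ≤ growthCount fac (r i) :=
      fun i hi => (ih (r i) (hcard i hi)).1
    refine ⟨hsum ▸ Finset.sum_nonneg hnonneg, fun a b hab => ?_⟩
    let g : Fin (t.n + 1) → ENNReal := fun v => if v ∈ t.removable then
      ENNReal.ofReal (growthCount fac (r v) * (b - a) ^ (k + 1) / (k + 1).factorial) else 0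
    have hterm : ∀ i : {v : Fin (t.n + 1) // v ∈ t.itemSet},
        (if ∀ j, ¬ t.itemRel j i then ∫⁻ s in Set.Ioo a b,
          volume (orderRegion (fun j k : {j // j ≠ i} => t.itemRel j k) s b) else 0) =
        g i := by
      intro i
      simp only [forall_not_itemRel_iff, g]
      split_ifs with hi
      · obtain ⟨f, hf⟩ := (hr i hi).exists_equiv
        rw [← lintegral_Ioo_sub_pow hab (by exact_mod_cast hnonneg i hi)]
        refine setLIntegral_congr_fun measurableSet_Ioo fun s hs => ?_
        rw [← volume_orderRegion_congr f hf, (ih (r i) (hcard i hi)).2 s b hs.2.le, edgeCount_eq,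
          hcard i hi]
      · rfl
    rw [volume_orderRegion_eq_sum, Finset.sum_congr rfl fun i _ => hterm i,
      Finset.sum_coe_sort t.itemSet g, ← Finset.sum_filter, edgeCount_eq, h, hsum,
      Finset.filter_mem_eq_inter, Finset.inter_eq_right.2 t.removable_subset,
      ← ENNReal.ofReal_sum_of_nonneg]
    · push_cast
      rw [Finset.sum_mul, Finset.sum_div]
    · intro i hi
      have : (0 : ℝ) ≤ growthCount fac (r i) := by exact_mod_cast hnonneg i hi
      have := sub_nonneg.2 hab
      positivity

theorem vertexTime_of_ne_zero {t : ExoticTree} {v : Fin (t.n + 1)} (hv : v ≠ 0) (s : ℝ)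
    (x : {v : Fin (t.n + 1) // v ∈ t.itemSet} → ℝ) :
    t.vertexTime s x v = x ⟨t.timeRep v, timeRep_mem_itemSet hv⟩ :=
  dif_pos (timeRep_mem_itemSet hv)

theorem vertexTime_zero (t : ExoticTree) (s : ℝ)
    (x : {v : Fin (t.n + 1) // v ∈ t.itemSet} → ℝ) : t.vertexTime s x 0 = s :=
  dif_neg fun h => timeRep_mem_itemSet_iff.1 h rfl

/-- On the open cube, times decrease along all edges exactly on the order region of the tree. -/
theorem mem_orderRegion_itemRel_iff {t : ExoticTree} {T s : ℝ} (hs : s ≤ T)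
    {x : {v : Fin (t.n + 1) // v ∈ t.itemSet} → ℝ} :
    x ∈ orderRegion t.itemRel 0 s ↔ (∀ i, x i ∈ Set.Ioo 0 T) ∧
      ∀ v, v ≠ 0 → t.vertexTime s x v < t.vertexTime s x (t.parent v) := by
  constructor
  · rintro ⟨hbox, hR⟩
    refine ⟨fun i => ⟨(hbox i).1, (hbox i).2.trans_le hs⟩, fun v hv => ?_⟩
    rw [vertexTime_of_ne_zero hv]
    by_cases hp : t.parent v = 0
    · rw [hp, vertexTime_zero]
      exact (hbox _).2
    · rw [vertexTime_of_ne_zero hp]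
      exact hR _ _ ⟨v, rfl, rfl⟩
  · rintro ⟨hbox, hedge⟩
    have hlt : ∀ k v, v ≠ 0 → t.parent^[k] v = 0 → t.vertexTime s x v < s := fun k => by
      induction k with
      | zero => exact fun v hv h => absurd h hv
      | succ k ih =>
        intro v hv h
        refine (hedge v hv).trans_le ?_
        by_cases hp : t.parent v = 0
        · rw [hp, vertexTime_zero]
        · exact (ih _ hp h).le
    refine ⟨fun i => ⟨(hbox i).1, ?_⟩, fun i j ⟨u, hi, hj⟩ => ?_⟩
    · have hi0 : (i : Fin (t.n + 1)) ≠ 0 := fun h => t.zero_notMem_itemSet (h ▸ i.2)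
      have := hlt t.n i hi0 (t.reaches_root _)
      rw [vertexTime_of_ne_zero hi0] at this
      rwa [← show (⟨t.timeRep i, timeRep_mem_itemSet hi0⟩ : {v // v ∈ t.itemSet}) = i from
        Subtype.ext (timeRep_of_mem_itemSet i.2)]
    · have hu0 : u ≠ 0 := timeRep_mem_itemSet_iff.1 (hi ▸ i.2)
      have hp0 : t.parent u ≠ 0 := timeRep_mem_itemSet_iff.1 (hj ▸ j.2)
      have := hedge u hu0
      rw [vertexTime_of_ne_zero hu0, vertexTime_of_ne_zero hp0] at this
      rwa [← show (⟨t.timeRep u, timeRep_mem_itemSet hu0⟩ : {v // v ∈ t.itemSet}) = i from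
        Subtype.ext hi, ← show (⟨t.timeRep (t.parent u), timeRep_mem_itemSet hp0⟩ :
          {v // v ∈ t.itemSet}) = j from Subtype.ext hj]

open MeasureTheory in
/-- The realization is the volume of the order region of the tree. -/
theorem realize_eq_volume (t : ExoticTree) {T s : ℝ} (hs : s ≤ T) :
    t.realize T s = volume.real (orderRegion t.itemRel 0 s) := by
  classical
  let ι := {v : Fin (t.n + 1) // v ∈ t.itemSet}
  have hbox : (Set.univ.pi fun _ : ι => Set.Icc (0 : ℝ) T) =ᵐ[volume]
      Set.univ.pi fun _ : ι => Set.Ioo (0 : ℝ) T := by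
    rw [volume_pi, Set.pi_univ_Icc]
    exact Measure.univ_pi_Ioo_ae_eq_Icc.symm
  have hmeas : MeasurableSet (Set.univ.pi fun _ : ι => Set.Ioo (0 : ℝ) T) :=
    .univ_pi fun _ => measurableSet_Ioo
  rw [realize, setIntegral_congr_set hbox, ← integral_indicator hmeas,
    ← integral_indicator_one (measurableSet_orderRegion _ _ _)]
  refine integral_congr_ae (.of_forall fun x => ?_)
  simp only [Set.indicator_apply, Set.mem_univ_pi, mem_orderRegion_itemRel_iff hs, Heaviside,
    sub_pos, Finset.prod_ite_zero, Finset.mem_filter, Finset.mem_univ, true_and,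
    Finset.prod_const_one, Pi.one_apply, ite_and]
  rfl

end ExoticTree

/-- Fix `T > 0`.  For every exotic coloured tree `τ` and every
`t ∈ [0, T]`, `Π^e_t(τ) = (|τ|!/τ!) · t^{𝔩(τ)}/𝔩(τ)!`, where `|τ|` is the effective
size, `𝔩(τ) = |τ| − 1`, and `τ!` is (any function satisfying the defining recursion
of) the exotic tree factorial. -/
theorem stmt8 (T : ℝ) (hT : 0 < T)
    (fac : ExoticTree → ℚ) (hfac : IsTreeFactorial fac)
    (t : ExoticTree) (x : ℝ) (hx : x ∈ Set.Icc (0 : ℝ) T) :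
    t.realize T x =
      ((Nat.factorial t.effSize : ℝ) / ((fac t : ℚ) : ℝ)) * x ^ t.edgeCount /
        (Nat.factorial t.edgeCount : ℝ) := by
  rw [realize_eq_volume t hx.2, MeasureTheory.measureReal_def,
    (volume_orderRegion_itemRel hfac t).2 0 x hx.1, ENNReal.toReal_ofReal, sub_zero, growthCount]
  · push_cast
    rfl
  · have : (0 : ℝ) ≤ growthCount fac t := by
      exact_mod_cast (volume_orderRegion_itemRel hfac t).1
    have := hx.1
    rw [sub_zero]
    positivity
end
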